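/- (Vargas's constant-fiber-length estimate.) Assume BH(s,r) holds for some 3/2 < s < 2 and r < s'. Let Ω ⊆ [0,1]² be measurable and for an integer K ≥ 0 set Ω(K) = {ξ ∈ Ω : 2^{-K-1} ≤ 𝓗¹({η : (ξ₁,η) ∈ Ω}) ≤ 2^{-K+1}}. Then there is a constant C (depending only on s, r and the BH constant) such that for every measurable Ω' ⊆ Ω(K), ∥𝓔χ_{Ω'}∥_{L^{2s}(ℝ³)} ≤ C |Ω(K)|^{1/s'}. -/

import Mathlib

open MeasureTheory Set
open scoped ENNReal

/-- The extension operator for the hyperbolic paraboloid `τ = ξ₁ξ₂` in `ℝ³`: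
`𝓔f(t,x) = ∫_{ℝ²} e^{i(tξ₁ξ₂ + x·ξ)} f(ξ) dξ`. -/
noncomputable def extOp (f : ℝ × ℝ → ℂ) (p : ℝ × ℝ × ℝ) : ℂ :=
  ∫ ξ : ℝ × ℝ,
    Complex.exp (Complex.I * (p.1 * ξ.1 * ξ.2 + p.2.1 * ξ.1 + p.2.2 * ξ.2 : ℝ)) * f ξ

/-- Characteristic function of a set, valued in `ℂ`. -/
noncomputable def chi (Ω : Set (ℝ × ℝ)) : ℝ × ℝ → ℂ := Ω.indicator fun _ => 1

/-- The axis-parallel unit square with lower-left corner `(a, b)`. -/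
def unitSq (a b : ℝ) : Set (ℝ × ℝ) := Icc a (a + 1) ×ˢ Icc b (b + 1)

/-- Bilinear hypothesis BH(s,r) with constant `A`: a bilinear adjoint restriction estimate
`∥𝓔f·𝓔g∥_{L^s} ≤ A ∥f∥_{L^r} ∥g∥_{L^r}` whenever `f, g` are supported in `1 × 1`
axis-parallel squares whose projections onto each coordinate axis are separated by a
distance between `1` and `4` (equivalently, the corners satisfy `2 ≤ |aᵢ - bᵢ| ≤ 5`). -/
def BH (s r A : ℝ) : Prop :=
  ∀ a₁ a₂ b₁ b₂ : ℝ, 2 ≤ |a₁ - b₁| → |a₁ - b₁| ≤ 5 → 2 ≤ |a₂ - b₂| → |a₂ - b₂| ≤ 5 →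
    ∀ f g : ℝ × ℝ → ℂ,
      Function.support f ⊆ unitSq a₁ a₂ → Function.support g ⊆ unitSq b₁ b₂ →
      eLpNorm (fun p => extOp f p * extOp g p) (ENNReal.ofReal s) volume ≤
        ENNReal.ofReal A * eLpNorm f (ENNReal.ofReal r) volume *
          eLpNorm g (ENNReal.ofReal r) volume


/-- The vertical fiber of `Ω ⊆ ℝ²` over `x`: `{η : (x, η) ∈ Ω}`. -/
def vFiber (Ω : Set (ℝ × ℝ)) (x : ℝ) : Set ℝ := {y | (x, y) ∈ Ω}

/-- `Ω(K) = {ξ ∈ Ω : 2^{-K-1} ≤ 𝓗¹({η : (ξ₁,η) ∈ Ω}) ≤ 2^{-K+1}}`, the piece of `Ω` whose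
vertical fibers have length about `2⁻ᴷ`. -/
noncomputable def fiberPiece (Ω : Set (ℝ × ℝ)) (K : ℕ) : Set (ℝ × ℝ) :=
  {ξ ∈ Ω | (2 : ℝ≥0∞) ^ (-(K : ℤ) - 1) ≤ volume (vFiber Ω ξ.1) ∧
    volume (vFiber Ω ξ.1) ≤ (2 : ℝ≥0∞) ^ (-(K : ℤ) + 1)}

lemma trig_cross (a : ℝ) (k : ℤ) :
    ∫ x in a..(a + 2 * Real.pi), Complex.exp (Complex.I * (k * x)) =
      if k = 0 then (2 * Real.pi : ℂ) else 0 := by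
  split_ifs with h
  · simp [h]
  · have hc : (Complex.I * k : ℂ) ≠ 0 := by simp [h]
    have := integral_exp_mul_complex (a := a) (b := a + 2 * Real.pi) hc
    simp only [← mul_assoc]
    rw [this]
    have : Complex.exp (Complex.I * k * ((a + 2 * Real.pi : ℝ) : ℂ)) =
        Complex.exp (Complex.I * k * (a : ℂ)) := by
      rw [Complex.exp_eq_exp_iff_exists_int]
      exact ⟨k, by push_cast; ring⟩
    rw [this]; simp

lemma trig_sq {ι : Type*} (N : Finset ι) (ν : ι → ℤ) (hν : Set.InjOn ν N) (c : ι → ℂ) (a : ℝ) :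
    ∫⁻ x in Ioc a (a + 2 * Real.pi), ‖∑ n ∈ N, c n * Complex.exp (Complex.I * (ν n * x))‖ₑ ^ 2 =
      ENNReal.ofReal (2 * Real.pi) * ∑ n ∈ N, ‖c n‖ₑ ^ 2 := by
  have hpi := Real.pi_pos
  set F : ℝ → ℂ := fun x => ∑ n ∈ N, c n * Complex.exp (Complex.I * (ν n * x)) with hF
  have hcont : Continuous F := by fun_prop
  have key : ∫ x in a..(a + 2 * Real.pi), ((‖F x‖ ^ 2 : ℝ) : ℂ) =
      ((2 * Real.pi * ∑ n ∈ N, ‖c n‖ ^ 2 : ℝ) : ℂ) := by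
    have e1 : ∀ x : ℝ, ((‖F x‖ ^ 2 : ℝ) : ℂ) =
        ∑ n ∈ N, ∑ m ∈ N, (c n * (starRingEnd ℂ) (c m)) *
          Complex.exp (Complex.I * ((ν n - ν m : ℤ) * x)) := by
      intro x
      have : ((‖F x‖ ^ 2 : ℝ) : ℂ) = F x * (starRingEnd ℂ) (F x) := by
        rw [Complex.mul_conj, Complex.normSq_eq_norm_sq]
      rw [this, hF]
      simp only [map_sum, map_mul]
      rw [Finset.sum_mul_sum]
      refine Finset.sum_congr rfl fun n _ => Finset.sum_congr rfl fun m _ => ?_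
      rw [← Complex.exp_conj]
      simp only [map_mul, Complex.conj_I, Complex.conj_ofReal, map_intCast]
      have : Complex.exp (Complex.I * ((ν n - ν m : ℤ) * x)) =
        Complex.exp (Complex.I * (ν n * x)) * Complex.exp (-Complex.I * (ν m * x)) := by
        rw [← Complex.exp_add]; congr 1; push_cast; ring
      rw [this]; ring
    simp_rw [e1]
    rw [intervalIntegral.integral_finsetSum]
    · rw [Complex.ofReal_mul, Complex.ofReal_sum, Finset.mul_sum]
      refine Finset.sum_congr rfl fun n hn => ?_
      rw [intervalIntegral.integral_finsetSum]
      · rw [Finset.sum_eq_single n]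
        · rw [intervalIntegral.integral_const_mul]
          have := trig_cross a (ν n - ν n)
          rw [this, if_pos (by ring), Complex.mul_conj, Complex.normSq_eq_norm_sq]
          push_cast; ring
        · intro m hm hmn
          rw [intervalIntegral.integral_const_mul]
          have := trig_cross a (ν n - ν m)
          rw [this, if_neg, mul_zero]
          intro h
          exact hmn (hν hm hn (by omega))
        · intro h; exact absurd hn h
      · intro m hm
        apply Continuous.intervalIntegrable; fun_prop
    · intro m hm
      apply Continuous.intervalIntegrable; fun_prop
  rw [intervalIntegral.integral_ofReal, Complex.ofReal_inj,
    intervalIntegral.integral_of_le (by linarith)] at key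
  have h2 : ∀ z : ℂ, ‖z‖ₑ ^ 2 = ENNReal.ofReal (‖z‖ ^ 2) := by
    intro z; rw [ENNReal.ofReal_pow (norm_nonneg _), ofReal_norm]
  simp_rw [h2]
  rw [← ofReal_integral_eq_lintegral_ofReal, key, ENNReal.ofReal_mul (by positivity),
    ENNReal.ofReal_sum_of_nonneg (fun _ _ => by positivity)]
  · have : Continuous fun x => ‖F x‖ ^ 2 := by fun_prop
    exact (this.integrableOn_Icc (a := a) (b := a + 2 * Real.pi)).mono_set Ioc_subset_Icc_self
  · exact Filter.Eventually.of_forall fun x => by positivity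

/-- Hoelder on a set of finite measure. -/
lemma lint_rpow_le {α : Type*} [MeasurableSpace α] (μ : Measure α) (f : α → ℝ≥0∞)
    (hf : AEMeasurable f μ) {p : ℝ} (hp : 1 ≤ p) :
    (∫⁻ x, f x ∂μ) ^ p ≤ μ univ ^ (p - 1) * ∫⁻ x, f x ^ p ∂μ := by
  rcases hp.eq_or_lt with rfl | hp
  · simp
  have hpq : p.HolderConjugate (p / (p - 1)) := Real.HolderConjugate.conjExponent hp
  have := ENNReal.lintegral_mul_le_Lp_mul_Lq μ hpq hf (aemeasurable_const (b := (1 : ℝ≥0∞)))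
  simp only [Pi.mul_apply, mul_one, ENNReal.one_rpow, lintegral_const, one_mul] at this
  have hp0 : 0 < p := by linarith
  calc (∫⁻ x, f x ∂μ) ^ p ≤ ((∫⁻ x, f x ^ p ∂μ) ^ (1 / p) * μ univ ^ (1 / (p / (p - 1)))) ^ p := by
        gcongr
    _ = _ := by
      rw [ENNReal.mul_rpow_of_nonneg _ _ hp0.le, ← ENNReal.rpow_mul, ← ENNReal.rpow_mul]
      have : 1 / p * p = 1 := by field_simp
      rw [this, ENNReal.rpow_one, mul_comm]
      congr 2
      have : p - 1 ≠ 0 := by linarith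
      field_simp

lemma trig_s {ι : Type*} (N : Finset ι) (ν : ι → ℤ) (hν : Set.InjOn ν N) (c : ι → ℂ) (a : ℝ)
    {s : ℝ} (hs0 : 0 < s) (hs2 : s ≤ 2) :
    ∫⁻ x in Ioc a (a + 2 * Real.pi), ‖∑ n ∈ N, c n * Complex.exp (Complex.I * (ν n * x))‖ₑ ^ s ≤
      ENNReal.ofReal (2 * Real.pi) * ∑ n ∈ N, ‖c n‖ₑ ^ s := by
  have hpi := Real.pi_pos
  set F : ℝ → ℂ := fun x => ∑ n ∈ N, c n * Complex.exp (Complex.I * (ν n * x)) with hF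
  have hcont : Continuous F := by fun_prop
  have h1 := lint_rpow_le (volume.restrict (Ioc a (a + 2 * Real.pi))) (fun x => ‖F x‖ₑ ^ s)
    (by fun_prop) (p := 2 / s) (by rw [le_div_iff₀ hs0]; linarith)
  have h2 := trig_sq N ν hν c a
  simp only [← ENNReal.rpow_mul] at h1
  have : s * (2 / s) = 2 := by field_simp
  rw [this] at h1
  simp only [ENNReal.rpow_two] at h1
  rw [h2] at h1
  simp only [MeasurableSet.univ, Measure.restrict_apply, univ_inter, Real.volume_Ioc,
    add_sub_cancel_left] at h1
  set T := ENNReal.ofReal (2 * Real.pi)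
  have hT0 : T ≠ 0 := by simp [T, hpi]
  have hTt : T ≠ ⊤ := ENNReal.ofReal_ne_top
  have h3 : ∑ n ∈ N, ‖c n‖ₑ ^ 2 ≤ (∑ n ∈ N, ‖c n‖ₑ ^ s) ^ (2 / s) := by
    have h : ∀ (M : Finset ι), ∑ n ∈ M, ‖c n‖ₑ ^ 2 ≤ (∑ n ∈ M, ‖c n‖ₑ ^ s) ^ (2 / s) := by
      intro M
      classical
      induction M using Finset.induction_on with
      | empty => simp
      | insert i M hi ih =>
        rw [Finset.sum_insert hi, Finset.sum_insert hi]
        refine le_trans ?_ (ENNReal.add_rpow_le_rpow_add _ _ (by rw [le_div_iff₀ hs0]; linarith))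
        rw [← ENNReal.rpow_mul, this, ENNReal.rpow_two]
        gcongr
    exact h N
  have h4 : (∫⁻ x in Ioc a (a + 2 * Real.pi), ‖F x‖ₑ ^ s) ^ (2 / s) ≤
      (T * ∑ n ∈ N, ‖c n‖ₑ ^ s) ^ (2 / s) := by
    refine h1.trans ?_
    rw [ENNReal.mul_rpow_of_nonneg _ _ (by positivity)]
    calc T ^ (2 / s - 1) * (T * ∑ n ∈ N, ‖c n‖ₑ ^ 2) = T ^ (2 / s) * ∑ n ∈ N, ‖c n‖ₑ ^ 2 := by
          rw [← mul_assoc]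
          congr 1
          conv_rhs => rw [show 2 / s = (2 / s - 1) + 1 by ring]
          rw [ENNReal.rpow_add _ _ hT0 hTt, ENNReal.rpow_one]
      _ ≤ _ := by gcongr
  exact (ENNReal.rpow_le_rpow_iff (by positivity)).1 h4


/-- One-dimensional Sobolev on a cell. -/
lemma sobolev_cell (W W' : ℝ → ℂ) (hW : ∀ y, HasDerivAt W (W' y) y) (hW' : Continuous W')
    (a L x : ℝ) (hx : x ∈ Ioc a (a + L)) :
    ENNReal.ofReal L * ‖W x‖ₑ ≤ ∫⁻ y in Ioc a (a + L), (‖W y‖ₑ + ENNReal.ofReal L * ‖W' y‖ₑ) := by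
  have hWc : Continuous W := continuous_iff_continuousAt.2 fun y => (hW y).continuousAt
  have h1 : ∀ y ∈ Ioc a (a + L), ‖W x‖ₑ ≤ ‖W y‖ₑ + ∫⁻ z in Ioc a (a + L), ‖W' z‖ₑ := by
    intro y hy
    have h2 : ∫ z in y..x, W' z = W x - W y :=
      intervalIntegral.integral_eq_sub_of_hasDerivAt (fun z _ => hW z) (hW'.intervalIntegrable _ _)
    have h3 : ‖W x - W y‖ₑ ≤ ∫⁻ z in Ioc a (a + L), ‖W' z‖ₑ := by
      rw [← h2]
      have : ‖∫ z in y..x, W' z‖ₑ = ‖∫ z in uIoc y x, W' z‖ₑ := by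
        rw [← ofReal_norm, ← ofReal_norm, intervalIntegral.norm_intervalIntegral_eq]
      rw [this]
      refine (enorm_integral_le_lintegral_enorm _).trans (lintegral_mono_set ?_)
      intro z hz
      rw [uIoc, mem_Ioc] at hz
      constructor
      · exact lt_trans (lt_min hy.1 hx.1 |>.trans_le le_rfl) hz.1
      · exact hz.2.trans (max_le hy.2 hx.2)
    calc ‖W x‖ₑ = ‖W y + (W x - W y)‖ₑ := by congr 1; ring
      _ ≤ ‖W y‖ₑ + ‖W x - W y‖ₑ := enorm_add_le _ _
      _ ≤ _ := by gcongr
  calc ENNReal.ofReal L * ‖W x‖ₑ = ∫⁻ y in Ioc a (a + L), ‖W x‖ₑ := by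
        simp [mul_comm]
    _ ≤ ∫⁻ y in Ioc a (a + L), (‖W y‖ₑ + ∫⁻ z in Ioc a (a + L), ‖W' z‖ₑ) :=
        setLIntegral_mono' measurableSet_Ioc h1
    _ = (∫⁻ y in Ioc a (a + L), ‖W y‖ₑ) + ENNReal.ofReal L * ∫⁻ z in Ioc a (a + L), ‖W' z‖ₑ := by
        rw [lintegral_add_left (by fun_prop)]
        simp [mul_comm]
    _ = _ := by
        rw [lintegral_add_left (by fun_prop), lintegral_const_mul _ (by fun_prop)]

lemma ortho_cell {ι : Type*} (N : Finset ι) (ν : ι → ℤ) (hν : Set.InjOn ν N)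
    {s : ℝ} (hs1 : 1 ≤ s) (hs2 : s ≤ 2) (G H : ι → ℝ → ℂ)
    (hG : ∀ n ∈ N, ∀ x, HasDerivAt (G n) (Complex.I * ν n * G n x + H n x) x)
    (hH : ∀ n ∈ N, Continuous (H n)) (a : ℝ) :
    ENNReal.ofReal (2 * Real.pi) ^ s *
      ∫⁻ x in Ioc a (a + 2 * Real.pi), ‖∑ n ∈ N, G n x‖ₑ ^ s ≤
      4 * ENNReal.ofReal (2 * Real.pi) ^ s *
      ∫⁻ y in Ioc a (a + 2 * Real.pi),
        ∑ n ∈ N, (‖G n y‖ₑ ^ s + ENNReal.ofReal (2 * Real.pi) ^ s * ‖H n y‖ₑ ^ s) := by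
  have hpi := Real.pi_pos
  have hs0 : 0 ≤ s := by linarith
  have hGc : ∀ n ∈ N, Continuous (G n) := fun n hn =>
    continuous_iff_continuousAt.2 fun y => (hG n hn y).continuousAt
  set T := ENNReal.ofReal (2 * Real.pi) with hT
  have hT0 : T ≠ 0 := by simp [T, hpi]
  have hTt : T ≠ ⊤ := ENNReal.ofReal_ne_top
  set I := Ioc a (a + 2 * Real.pi) with hI
  -- modulated coefficients
  set c : ι → ℝ → ℂ := fun n y => Complex.exp (-(Complex.I * (ν n * y))) * G n y with hc
  set e : ι → ℝ → ℂ := fun n y => Complex.exp (-(Complex.I * (ν n * y))) * H n y with he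
  have hcc : ∀ n ∈ N, Continuous (c n) := fun n hn => by
    have := hGc n hn; fun_prop
  have hec : ∀ n ∈ N, Continuous (e n) := fun n hn => by
    have := hH n hn; fun_prop
  have hnorm : ∀ n y, ‖Complex.exp (-(Complex.I * (ν n * y : ℝ)))‖ₑ = 1 := by
    intro n y
    rw [← ofReal_norm]
    have : -(Complex.I * ((ν n * y : ℝ) : ℂ)) = ((-(ν n * y) : ℝ) : ℂ) * Complex.I := by
      push_cast; ring
    rw [this, Complex.norm_exp_ofReal_mul_I]; simp
  have hcn : ∀ n y, ‖c n y‖ₑ = ‖G n y‖ₑ := by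
    intro n y
    have := hnorm n y
    push_cast at this
    simp only [hc, enorm_mul]
    rw [this, one_mul]
  have hen : ∀ n y, ‖e n y‖ₑ = ‖H n y‖ₑ := by
    intro n y
    have := hnorm n y
    push_cast at this
    simp only [he, enorm_mul]
    rw [this, one_mul]
  have hcd : ∀ n ∈ N, ∀ y, HasDerivAt (c n) (e n y) y := by
    intro n hn y
    have h1 : HasDerivAt (fun y : ℝ => Complex.exp (-(Complex.I * (ν n * y))))
        (Complex.exp (-(Complex.I * (ν n * y))) * (-(Complex.I * (ν n * 1)))) y := by
      refine HasDerivAt.cexp ?_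
      exact ((Complex.ofRealCLM.hasDerivAt.const_mul _).const_mul _).neg
    refine (h1.mul (hG n hn y)).congr_deriv ?_
    simp only [e]; ring
  set P : ℝ → ℝ → ℂ := fun x y => ∑ n ∈ N, c n y * Complex.exp (Complex.I * (ν n * x)) with hP
  set Q : ℝ → ℝ → ℂ := fun x y => ∑ n ∈ N, e n y * Complex.exp (Complex.I * (ν n * x)) with hQ
  have hPc : Continuous (fun z : ℝ × ℝ => P z.1 z.2) := by
    refine continuous_finsetSum _ fun n hn => ?_
    have := hcc n hn; fun_prop
  have hQc : Continuous (fun z : ℝ × ℝ => Q z.1 z.2) := by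
    refine continuous_finsetSum _ fun n hn => ?_
    have := hec n hn; fun_prop
  have hPx : ∀ x, P x x = ∑ n ∈ N, G n x := by
    intro x
    refine Finset.sum_congr rfl fun n _ => ?_
    simp only [c]
    rw [mul_right_comm, ← Complex.exp_add]; simp
  have hptw : ∀ x ∈ I, T ^ s * ‖∑ n ∈ N, G n x‖ₑ ^ s ≤
      T ^ (s - 1) * ∫⁻ y in I, 2 ^ (s - 1) * (‖P x y‖ₑ ^ s + T ^ s * ‖Q x y‖ₑ ^ s) := by
    intro x hx
    have h1 := sobolev_cell (P x) (Q x) (fun y => by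
      refine HasDerivAt.fun_sum fun n hn => ?_
      exact (hcd n hn y).mul_const _) (by fun_prop) a (2 * Real.pi) x hx
    have h2 := lint_rpow_le (volume.restrict I) (fun y => ‖P x y‖ₑ + T * ‖Q x y‖ₑ)
      (by fun_prop) hs1
    rw [← hPx, ← ENNReal.mul_rpow_of_nonneg _ _ hs0]
    refine (ENNReal.rpow_le_rpow h1 hs0).trans (h2.trans ?_)
    have hvol : (volume.restrict I) univ = T := by simp [hI, hT]
    rw [hvol]
    refine mul_le_mul_right (lintegral_mono fun y => ?_) _
    rw [← ENNReal.mul_rpow_of_nonneg _ _ hs0]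
    exact ENNReal.rpow_add_le_mul_rpow_add_rpow _ _ hs1
  calc T ^ s * ∫⁻ x in I, ‖∑ n ∈ N, G n x‖ₑ ^ s
      = ∫⁻ x in I, T ^ s * ‖∑ n ∈ N, G n x‖ₑ ^ s := by
        rw [lintegral_const_mul']
        exact ENNReal.rpow_ne_top_of_nonneg hs0 hTt
    _ ≤ ∫⁻ x in I, T ^ (s - 1) * ∫⁻ y in I, 2 ^ (s - 1) * (‖P x y‖ₑ ^ s + T ^ s * ‖Q x y‖ₑ ^ s) :=
        setLIntegral_mono' measurableSet_Ioc hptw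
    _ = T ^ (s - 1) * ∫⁻ y in I, ∫⁻ x in I, 2 ^ (s - 1) * (‖P x y‖ₑ ^ s + T ^ s * ‖Q x y‖ₑ ^ s) := by
        rw [lintegral_const_mul' _ _ (ENNReal.rpow_ne_top_of_nonneg (by linarith) hTt),
          lintegral_lintegral_swap]
        apply Measurable.aemeasurable
        simp only [Function.uncurry_def]
        fun_prop
    _ ≤ T ^ (s - 1) * ∫⁻ y in I, 2 * (T * ∑ n ∈ N, (‖G n y‖ₑ ^ s + T ^ s * ‖H n y‖ₑ ^ s)) := by
        refine mul_le_mul_right (lintegral_mono fun y => ?_) _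
        rw [lintegral_const_mul' _ _ (ENNReal.rpow_ne_top_of_nonneg (by linarith) (by simp)),
          lintegral_add_left (by fun_prop), 
          lintegral_const_mul' _ _ (ENNReal.rpow_ne_top_of_nonneg (by linarith) hTt)]
        refine mul_le_mul' ?_ ?_
        · calc (2 : ℝ≥0∞) ^ (s - 1) ≤ 2 ^ (1 : ℝ) :=
                ENNReal.rpow_le_rpow_of_exponent_le (by norm_num) (by linarith)
            _ = 2 := by simp
        · rw [Finset.sum_add_distrib, ← Finset.mul_sum, mul_add]
          have hp := trig_s N ν hν (fun n => c n y) a (s := s) (by linarith) hs2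
          have hq := trig_s N ν hν (fun n => e n y) a (s := s) (by linarith) hs2
          simp only [hcn, hen] at hp hq
          refine add_le_add hp ?_
          rw [mul_left_comm]
          exact mul_le_mul_right hq _
    _ = T ^ (s - 1) * T * 2 * ∫⁻ y in I, ∑ n ∈ N, (‖G n y‖ₑ ^ s + T ^ s * ‖H n y‖ₑ ^ s) := by
        rw [lintegral_const_mul' _ _ (by simp), lintegral_const_mul' _ _ hTt]; ring
    _ ≤ _ := by
        have : T ^ s = T ^ (s - 1) * T := by
          conv_lhs => rw [show s = (s - 1) + 1 by ring]
          rw [ENNReal.rpow_add _ _ hT0 hTt, ENNReal.rpow_one]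
        rw [← this, mul_comm (T ^ s) 2]
        gcongr
        norm_num

lemma lint_cells (f : ℝ → ℝ≥0∞) {L : ℝ} (hL : 0 < L) :
    ∫⁻ x, f x = ∑' n : ℤ, ∫⁻ x in Ioc (n • L) (n • L + L), f x := by
  have h := iUnion_Ioc_zsmul hL
  rw [← setLIntegral_univ, ← h, lintegral_iUnion]
  · simp only [add_smul, one_smul]
  · exact fun n => measurableSet_Ioc
  · exact pairwise_disjoint_Ioc_zsmul L

/-- One-dimensional almost orthogonality. -/
lemma ortho_line {s : ℝ} (hs1 : 1 ≤ s) (hs2 : s ≤ 2) : ∃ C : ℝ≥0∞, C ≠ ⊤ ∧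
    ∀ {ι : Type} (N : Finset ι) (ν : ι → ℤ), Set.InjOn ν N → ∀ (G H : ι → ℝ → ℂ),
    (∀ n ∈ N, ∀ x, HasDerivAt (G n) (Complex.I * ν n * G n x + H n x) x) →
    (∀ n ∈ N, Continuous (H n)) → 
      ∫⁻ x, ‖∑ n ∈ N, G n x‖ₑ ^ s ≤
      C * ∑ n ∈ N, ((∫⁻ x, ‖G n x‖ₑ ^ s) + ∫⁻ x, ‖H n x‖ₑ ^ s) := by
  have hpi := Real.pi_pos
  have hs0 : 0 ≤ s := by linarith
  set T := ENNReal.ofReal (2 * Real.pi) with hT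
  have hT0 : T ≠ 0 := by simp [T, hpi]
  have hTt : T ≠ ⊤ := ENNReal.ofReal_ne_top
  have hTs : T ^ s ≠ ⊤ := ENNReal.rpow_ne_top_of_nonneg hs0 hTt
  have hTs0 : T ^ s ≠ 0 := by simp [hT0, hTt]
  have hTs1 : 1 ≤ T ^ s := by
    apply ENNReal.one_le_rpow
    · rw [hT, ENNReal.one_le_ofReal]; linarith [Real.pi_gt_three]
    · linarith
  refine ⟨4 * T ^ s, ENNReal.mul_ne_top (by simp) hTs, ?_⟩
  intro ι N ν hν G H hG hH
  have hGc : ∀ n ∈ N, Continuous (G n) := fun n hn =>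
    continuous_iff_continuousAt.2 fun y => (hG n hn y).continuousAt
  have h1 : ∀ a : ℝ, ∫⁻ x in Ioc a (a + 2 * Real.pi), ‖∑ n ∈ N, G n x‖ₑ ^ s ≤
      4 * T ^ s * ∫⁻ y in Ioc a (a + 2 * Real.pi), ∑ n ∈ N, (‖G n y‖ₑ ^ s + ‖H n y‖ₑ ^ s) := by
    intro a
    have h2 := ortho_cell N ν hν hs1 hs2 G H hG hH a
    rw [← hT] at h2
    have h3 : T ^ s * ∫⁻ x in Ioc a (a + 2 * Real.pi), ‖∑ n ∈ N, G n x‖ₑ ^ s ≤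
      T ^ s * (4 * T ^ s *
        ∫⁻ y in Ioc a (a + 2 * Real.pi), ∑ n ∈ N, (‖G n y‖ₑ ^ s + ‖H n y‖ₑ ^ s)) := by
      refine h2.trans ?_
      rw [mul_left_comm, ← lintegral_const_mul' _ _ hTs]
      gcongr with y
      rw [Finset.mul_sum]
      gcongr with n
      rw [mul_add]
      gcongr
      exact le_mul_of_one_le_left zero_le hTs1
    exact (ENNReal.mul_le_mul_iff_right hTs0 hTs).1 h3
  have h4 : ∑ n ∈ N, ((∫⁻ x, ‖G n x‖ₑ ^ s) + ∫⁻ x, ‖H n x‖ₑ ^ s) =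
      ∫⁻ x, ∑ n ∈ N, (‖G n x‖ₑ ^ s + ‖H n x‖ₑ ^ s) := by
    rw [lintegral_finsetSum']
    · refine Finset.sum_congr rfl fun n hn => ?_
      have := hGc n hn
      rw [lintegral_add_left (by fun_prop)]
    · intro n hn
      have := hGc n hn
      have := hH n hn
      fun_prop
  rw [h4, lint_cells _ (L := 2 * Real.pi) (by positivity), 
    lint_cells (fun x => ∑ n ∈ N, (‖G n x‖ₑ ^ s + ‖H n x‖ₑ ^ s)) (L := 2 * Real.pi) (by positivity),
    ← ENNReal.tsum_mul_left]
  exact ENNReal.tsum_le_tsum fun n => h1 _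


lemma lint3 (F : ℝ × ℝ × ℝ → ℝ≥0∞) (hF : Measurable F) :
    ∫⁻ p, F p = ∫⁻ t, ∫⁻ x, ∫⁻ y, F (t, x, y) := by
  rw [Measure.volume_eq_prod, lintegral_prod _ hF.aemeasurable]
  congr 1; ext t
  rw [Measure.volume_eq_prod, lintegral_prod _ (by fun_prop)]

lemma lint3' (F : ℝ × ℝ × ℝ → ℝ≥0∞) (hF : Measurable F) :
    ∫⁻ p, F p = ∫⁻ t, ∫⁻ y, ∫⁻ x, F (t, x, y) := by
  rw [Measure.volume_eq_prod, lintegral_prod _ hF.aemeasurable]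
  congr 1; ext t
  rw [Measure.volume_eq_prod, lintegral_prod_symm _ (by fun_prop)]

/-- Almost orthogonality in the second space variable, integrated over all of `ℝ³`. -/
lemma ortho_x2 {s : ℝ} (hs1 : 1 ≤ s) (hs2 : s ≤ 2) : ∃ C : ℝ≥0∞, C ≠ ⊤ ∧
    ∀ (N : Finset ℤ) (ν : ℤ → ℤ), Set.InjOn ν N → ∀ (G H : ℤ → ℝ × ℝ × ℝ → ℂ),
    (∀ n ∈ N, ∀ t x y, HasDerivAt (fun y => G n (t, x, y))
      (Complex.I * ν n * G n (t, x, y) + H n (t, x, y)) y) →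
    (∀ n ∈ N, Continuous (G n)) → (∀ n ∈ N, Continuous (H n)) →
      ∫⁻ p, ‖∑ n ∈ N, G n p‖ₑ ^ s ≤
      C * ∑ n ∈ N, ((∫⁻ p, ‖G n p‖ₑ ^ s) + ∫⁻ p, ‖H n p‖ₑ ^ s) := by
  obtain ⟨C, hC, h⟩ := ortho_line hs1 hs2
  refine ⟨C, hC, fun N ν hν G H hG hGc hHc => ?_⟩
  have hm : Measurable fun p => ‖∑ n ∈ N, G n p‖ₑ ^ s := by
    have : Continuous fun p => ∑ n ∈ N, G n p := continuous_finsetSum _ hGc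
    fun_prop
  have hGm : ∀ n ∈ N, Measurable fun p => ‖G n p‖ₑ ^ s := fun n hn => by
    have := hGc n hn; fun_prop
  have hHm : ∀ n ∈ N, Measurable fun p => ‖H n p‖ₑ ^ s := fun n hn => by
    have := hHc n hn; fun_prop
  have hGH : ∀ n ∈ N, Measurable fun p => ‖G n p‖ₑ ^ s + ‖H n p‖ₑ ^ s :=
    fun n hn => (hGm n hn).add (hHm n hn)
  have e : ∑ n ∈ N, ((∫⁻ p, ‖G n p‖ₑ ^ s) + ∫⁻ p, ‖H n p‖ₑ ^ s) =
      ∫⁻ t, ∫⁻ x, ∑ n ∈ N, ((∫⁻ y, ‖G n (t, x, y)‖ₑ ^ s) + ∫⁻ y, ‖H n (t, x, y)‖ₑ ^ s) := by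
    have : ∑ n ∈ N, ((∫⁻ p, ‖G n p‖ₑ ^ s) + ∫⁻ p, ‖H n p‖ₑ ^ s) =
        ∫⁻ p, ∑ n ∈ N, (‖G n p‖ₑ ^ s + ‖H n p‖ₑ ^ s) := by
      rw [lintegral_finsetSum' _ fun n hn => (hGH n hn).aemeasurable]
      refine Finset.sum_congr rfl fun n hn => ?_
      rw [lintegral_add_left (hGm n hn)]
    rw [this, lint3 _ (Finset.measurable_fun_sum _ hGH)]
    congr 1; ext t; congr 1; ext x
    rw [lintegral_finsetSum']
    · refine Finset.sum_congr rfl fun n hn => ?_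
      rw [lintegral_add_left]
      exact (hGm n hn).comp (by fun_prop)
    · exact fun n hn => ((hGH n hn).comp (by fun_prop)).aemeasurable
  rw [lint3 _ hm, e, ← lintegral_const_mul' _ _ hC]
  refine lintegral_mono fun t => ?_
  rw [← lintegral_const_mul' _ _ hC]
  refine lintegral_mono fun x => ?_
  refine h N ν hν (fun n y => G n (t, x, y)) (fun n y => H n (t, x, y))
    (fun n hn y => hG n hn t x y) (fun n hn => ?_)
  have := hHc n hn
  fun_prop

/-- Almost orthogonality in the first space variable, integrated over all of `ℝ³`. -/
lemma ortho_x1 {s : ℝ} (hs1 : 1 ≤ s) (hs2 : s ≤ 2) : ∃ C : ℝ≥0∞, C ≠ ⊤ ∧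
    ∀ (N : Finset ℤ) (ν : ℤ → ℤ), Set.InjOn ν N → ∀ (G H : ℤ → ℝ × ℝ × ℝ → ℂ),
    (∀ n ∈ N, ∀ t x y, HasDerivAt (fun x => G n (t, x, y))
      (Complex.I * ν n * G n (t, x, y) + H n (t, x, y)) x) →
    (∀ n ∈ N, Continuous (G n)) → (∀ n ∈ N, Continuous (H n)) →
      ∫⁻ p, ‖∑ n ∈ N, G n p‖ₑ ^ s ≤
      C * ∑ n ∈ N, ((∫⁻ p, ‖G n p‖ₑ ^ s) + ∫⁻ p, ‖H n p‖ₑ ^ s) := by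
  obtain ⟨C, hC, h⟩ := ortho_line hs1 hs2
  refine ⟨C, hC, fun N ν hν G H hG hGc hHc => ?_⟩
  have hm : Measurable fun p => ‖∑ n ∈ N, G n p‖ₑ ^ s := by
    have : Continuous fun p => ∑ n ∈ N, G n p := continuous_finsetSum _ hGc
    fun_prop
  have hGm : ∀ n ∈ N, Measurable fun p => ‖G n p‖ₑ ^ s := fun n hn => by
    have := hGc n hn; fun_prop
  have hHm : ∀ n ∈ N, Measurable fun p => ‖H n p‖ₑ ^ s := fun n hn => by
    have := hHc n hn; fun_prop
  have hGH : ∀ n ∈ N, Measurable fun p => ‖G n p‖ₑ ^ s + ‖H n p‖ₑ ^ s :=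
    fun n hn => (hGm n hn).add (hHm n hn)
  have e : ∑ n ∈ N, ((∫⁻ p, ‖G n p‖ₑ ^ s) + ∫⁻ p, ‖H n p‖ₑ ^ s) =
      ∫⁻ t, ∫⁻ y, ∑ n ∈ N, ((∫⁻ x, ‖G n (t, x, y)‖ₑ ^ s) + ∫⁻ x, ‖H n (t, x, y)‖ₑ ^ s) := by
    have : ∑ n ∈ N, ((∫⁻ p, ‖G n p‖ₑ ^ s) + ∫⁻ p, ‖H n p‖ₑ ^ s) =
        ∫⁻ p, ∑ n ∈ N, (‖G n p‖ₑ ^ s + ‖H n p‖ₑ ^ s) := by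
      rw [lintegral_finsetSum' _ fun n hn => (hGH n hn).aemeasurable]
      refine Finset.sum_congr rfl fun n hn => ?_
      rw [lintegral_add_left (hGm n hn)]
    rw [this, lint3' _ (Finset.measurable_fun_sum _ hGH)]
    congr 1; ext t; congr 1; ext y
    rw [lintegral_finsetSum']
    · refine Finset.sum_congr rfl fun n hn => ?_
      rw [lintegral_add_left]
      exact (hGm n hn).comp (g := fun p => ‖G n p‖ₑ ^ s) (f := fun x => (t, x, y)) (by fun_prop)
    · exact fun n hn => ((hGH n hn).comp (f := fun x => (t, x, y)) (by fun_prop)).aemeasurable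
  rw [lint3' _ hm, e, ← lintegral_const_mul' _ _ hC]
  refine lintegral_mono fun t => ?_
  rw [← lintegral_const_mul' _ _ hC]
  refine lintegral_mono fun y => ?_
  refine h N ν hν (fun n x => G n (t, x, y)) (fun n x => H n (t, x, y))
    (fun n hn x => hG n hn t x y) (fun n hn => ?_)
  have := hHc n hn
  fun_prop

/-- Two-parameter almost orthogonality. -/
lemma ortho2 {s : ℝ} (hs1 : 1 ≤ s) (hs2 : s ≤ 2) : ∃ C : ℝ≥0∞, C ≠ ⊤ ∧
    ∀ (N₁ N₂ : Finset ℤ) (ν₁ ν₂ : ℤ → ℤ), Set.InjOn ν₁ N₁ → Set.InjOn ν₂ N₂ →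
    ∀ (G H₁ H₂ H₃ : ℤ → ℤ → ℝ × ℝ × ℝ → ℂ),
    (∀ n m t x y, HasDerivAt (fun x => G n m (t, x, y))
      (Complex.I * ν₁ n * G n m (t, x, y) + H₁ n m (t, x, y)) x) →
    (∀ n m t x y, HasDerivAt (fun y => G n m (t, x, y))
      (Complex.I * ν₂ m * G n m (t, x, y) + H₂ n m (t, x, y)) y) →
    (∀ n m t x y, HasDerivAt (fun y => H₁ n m (t, x, y))
      (Complex.I * ν₂ m * H₁ n m (t, x, y) + H₃ n m (t, x, y)) y) →
    (∀ n m, Continuous (G n m)) → (∀ n m, Continuous (H₁ n m)) →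
    (∀ n m, Continuous (H₂ n m)) → (∀ n m, Continuous (H₃ n m)) →
      ∫⁻ p, ‖∑ n ∈ N₁, ∑ m ∈ N₂, G n m p‖ₑ ^ s ≤
      C * ∑ n ∈ N₁, ∑ m ∈ N₂, ((∫⁻ p, ‖G n m p‖ₑ ^ s) + (∫⁻ p, ‖H₁ n m p‖ₑ ^ s) +
        (∫⁻ p, ‖H₂ n m p‖ₑ ^ s) + ∫⁻ p, ‖H₃ n m p‖ₑ ^ s) := by
  obtain ⟨C, hC, h⟩ := ortho_x1 hs1 hs2
  obtain ⟨D, hD, h'⟩ := ortho_x2 hs1 hs2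
  refine ⟨C * D, ENNReal.mul_ne_top hC hD, ?_⟩
  intro N₁ N₂ ν₁ ν₂ hν₁ hν₂ G H₁ H₂ H₃ h1 h2 h3 cG c1 c2 c3
  refine (h N₁ ν₁ hν₁ (fun n p => ∑ m ∈ N₂, G n m p) (fun n p => ∑ m ∈ N₂, H₁ n m p)
    ?_ ?_ ?_).trans ?_
  · intro n _ t x y
    refine (HasDerivAt.fun_sum fun m _ => h1 n m t x y).congr_deriv ?_
    rw [Finset.sum_add_distrib, Finset.mul_sum]
  · intro n _; fun_prop
  · intro n _; fun_prop
  · rw [mul_assoc, Finset.mul_sum (a := D)]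
    refine mul_le_mul_right (Finset.sum_le_sum fun n hn => ?_) _
    have a1 := h' N₂ ν₂ hν₂ (G n) (H₂ n) (fun m _ => h2 n m) (fun m _ => cG n m) (fun m _ => c2 n m)
    have a2 := h' N₂ ν₂ hν₂ (H₁ n) (H₃ n) (fun m _ => h3 n m) (fun m _ => c1 n m) (fun m _ => c3 n m)
    refine (add_le_add a1 a2).trans (le_of_eq ?_)
    rw [← mul_add, ← Finset.sum_add_distrib]
    congr 1
    refine Finset.sum_congr rfl fun m _ => ?_
    ring


lemma phase_norm (θ : ℝ) : ‖Complex.exp (Complex.I * (θ : ℂ))‖ = 1 := by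
  rw [mul_comm, Complex.norm_exp_ofReal_mul_I]

lemma phase_integrable {f : ℝ × ℝ → ℂ} (hf : Integrable f) (p : ℝ × ℝ × ℝ) :
    Integrable fun ξ : ℝ × ℝ =>
      Complex.exp (Complex.I * (p.1 * ξ.1 * ξ.2 + p.2.1 * ξ.1 + p.2.2 * ξ.2 : ℝ)) * f ξ := by
  refine hf.bdd_mul (c := 1) (Continuous.aestronglyMeasurable (by fun_prop)) ?_
  exact Filter.Eventually.of_forall fun ξ => (phase_norm _).le

lemma extOp_continuous {f : ℝ × ℝ → ℂ} (hf : Integrable f) : Continuous (extOp f) := by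
  unfold extOp
  refine continuous_of_dominated (bound := fun ξ => ‖f ξ‖) ?_ ?_ hf.norm ?_
  · exact fun p => (phase_integrable hf p).aestronglyMeasurable
  · intro p
    refine Filter.Eventually.of_forall fun ξ => ?_
    rw [norm_mul, phase_norm, one_mul]
  · refine Filter.Eventually.of_forall fun ξ => ?_
    fun_prop

lemma extOp_deriv1 {f : ℝ × ℝ → ℂ} (hf : Integrable f)
    (hf' : Integrable fun ξ : ℝ × ℝ => Complex.I * ξ.1 * f ξ) (t x y : ℝ) :
    HasDerivAt (fun x => extOp f (t, x, y))
      (extOp (fun ξ : ℝ × ℝ => Complex.I * ξ.1 * f ξ) (t, x, y)) x := by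
  unfold extOp
  refine (hasDerivAt_integral_of_dominated_loc_of_deriv_le
    (F := fun (x : ℝ) (ξ : ℝ × ℝ) =>
      Complex.exp (Complex.I * (t * ξ.1 * ξ.2 + x * ξ.1 + y * ξ.2 : ℝ)) * f ξ)
    (F' := fun (x : ℝ) (ξ : ℝ × ℝ) =>
      Complex.exp (Complex.I * (t * ξ.1 * ξ.2 + x * ξ.1 + y * ξ.2 : ℝ)) * (Complex.I * ξ.1 * f ξ))
    (bound := fun ξ => ‖Complex.I * ξ.1 * f ξ‖) (s := univ) (x₀ := x) Filter.univ_mem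
    ?_ (phase_integrable hf (t, x, y)) ?_ ?_ hf'.norm ?_).2
  · exact Filter.Eventually.of_forall fun x => (phase_integrable hf (t, x, y)).aestronglyMeasurable
  · exact (phase_integrable hf' (t, x, y)).aestronglyMeasurable
  · refine Filter.Eventually.of_forall fun ξ x _ => ?_
    rw [norm_mul, phase_norm, one_mul]
  · refine Filter.Eventually.of_forall fun ξ x _ => ?_
    rw [← mul_assoc]
    refine HasDerivAt.mul_const (HasDerivAt.cexp ?_) _
    have : HasDerivAt (fun x : ℝ => (t * ξ.1 * ξ.2 + x * ξ.1 + y * ξ.2 : ℝ)) ξ.1 x := by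
      simpa using (((hasDerivAt_id x).mul_const ξ.1).const_add (t * ξ.1 * ξ.2)).add_const (y * ξ.2)
    exact (this.ofReal_comp).const_mul _

lemma extOp_deriv2 {f : ℝ × ℝ → ℂ} (hf : Integrable f)
    (hf' : Integrable fun ξ : ℝ × ℝ => Complex.I * ξ.2 * f ξ) (t x y : ℝ) :
    HasDerivAt (fun y => extOp f (t, x, y))
      (extOp (fun ξ : ℝ × ℝ => Complex.I * ξ.2 * f ξ) (t, x, y)) y := by
  unfold extOp
  refine (hasDerivAt_integral_of_dominated_loc_of_deriv_le
    (F := fun (y : ℝ) (ξ : ℝ × ℝ) =>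
      Complex.exp (Complex.I * (t * ξ.1 * ξ.2 + x * ξ.1 + y * ξ.2 : ℝ)) * f ξ)
    (F' := fun (y : ℝ) (ξ : ℝ × ℝ) =>
      Complex.exp (Complex.I * (t * ξ.1 * ξ.2 + x * ξ.1 + y * ξ.2 : ℝ)) * (Complex.I * ξ.2 * f ξ))
    (bound := fun ξ => ‖Complex.I * ξ.2 * f ξ‖) (s := univ) (x₀ := y) Filter.univ_mem
    ?_ (phase_integrable hf (t, x, y)) ?_ ?_ hf'.norm ?_).2
  · exact Filter.Eventually.of_forall fun y => (phase_integrable hf (t, x, y)).aestronglyMeasurable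
  · exact (phase_integrable hf' (t, x, y)).aestronglyMeasurable
  · refine Filter.Eventually.of_forall fun ξ y _ => ?_
    rw [norm_mul, phase_norm, one_mul]
  · refine Filter.Eventually.of_forall fun ξ y _ => ?_
    rw [← mul_assoc]
    refine HasDerivAt.mul_const (HasDerivAt.cexp ?_) _
    have : HasDerivAt (fun y : ℝ => (t * ξ.1 * ξ.2 + x * ξ.1 + y * ξ.2 : ℝ)) ξ.2 y := by
      simpa using ((hasDerivAt_id y).mul_const ξ.2).const_add (t * ξ.1 * ξ.2 + x * ξ.1)
    exact (this.ofReal_comp).const_mul _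

lemma extOp_add {f g : ℝ × ℝ → ℂ} (hf : Integrable f) (hg : Integrable g) (p : ℝ × ℝ × ℝ) :
    extOp (fun ξ => f ξ + g ξ) p = extOp f p + extOp g p := by
  unfold extOp
  simp only [mul_add]
  exact integral_add (phase_integrable hf p) (phase_integrable hg p)

lemma extOp_smul (c : ℂ) (f : ℝ × ℝ → ℂ) (p : ℝ × ℝ × ℝ) :
    extOp (fun ξ => c * f ξ) p = c * extOp f p := by
  unfold extOp
  rw [← integral_const_mul]
  congr 1; ext ξ; ring

/-- The half-open integer unit cell. -/
def cell (n m : ℤ) : Set (ℝ × ℝ) := {ξ | ⌊ξ.1⌋ = n ∧ ⌊ξ.2⌋ = m}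

lemma cell_measurable (n m : ℤ) : MeasurableSet (cell n m) := by
  have h1 : Measurable fun ξ : ℝ × ℝ => ⌊ξ.1⌋ := by fun_prop
  have h2 : Measurable fun ξ : ℝ × ℝ => ⌊ξ.2⌋ := by fun_prop
  exact (h1 (measurableSet_singleton n)).inter (h2 (measurableSet_singleton m))

lemma cell_subset (n m : ℤ) : cell n m ⊆ unitSq n m := by
  rintro ξ ⟨h1, h2⟩
  rw [Int.floor_eq_iff] at h1 h2
  exact ⟨⟨h1.1, h1.2.le⟩, ⟨h2.1, h2.2.le⟩⟩

lemma unitSq_volume (a b : ℝ) : volume (unitSq a b) = 1 := by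
  unfold unitSq
  rw [Measure.volume_eq_prod, Measure.prod_prod]; simp

/-- Functions dominated by the characteristic function of `S ∩ cell n m`. -/
structure Good (S : Set (ℝ × ℝ)) (n m : ℤ) (f : ℝ × ℝ → ℂ) : Prop where
  meas : Measurable f
  bound : ∀ ξ, ‖f ξ‖ ≤ (S ∩ cell n m).indicator (fun _ => (1 : ℝ)) ξ

lemma Good.integrable {S : Set (ℝ × ℝ)} (hS : MeasurableSet S) {n m : ℤ} {f : ℝ × ℝ → ℂ}
    (h : Good S n m f) : Integrable f := by
  have hm := hS.inter (cell_measurable n m)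
  have : Integrable ((S ∩ cell n m).indicator (fun _ => (1 : ℝ))) := by
    rw [integrable_indicator_iff hm]
    refine integrableOn_const ?_
    refine ne_top_of_le_ne_top ?_ (measure_mono (inter_subset_right.trans (cell_subset n m)))
    rw [unitSq_volume]; simp
  exact this.mono' h.meas.aestronglyMeasurable (Filter.Eventually.of_forall h.bound)

/-- Modulated multiplier in the first variable. -/
noncomputable def M1 (n : ℤ) (f : ℝ × ℝ → ℂ) : ℝ × ℝ → ℂ :=
  fun ξ => Complex.I * (ξ.1 - n : ℝ) * f ξ

/-- Modulated multiplier in the second variable. -/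
noncomputable def M2 (n : ℤ) (f : ℝ × ℝ → ℂ) : ℝ × ℝ → ℂ :=
  fun ξ => Complex.I * (ξ.2 - n : ℝ) * f ξ

lemma Good.zero_of_not {S : Set (ℝ × ℝ)} {n m : ℤ} {f : ℝ × ℝ → ℂ}
    (h : Good S n m f) {ξ} (hξ : ξ ∉ S ∩ cell n m) : f ξ = 0 := by
  have := h.bound ξ
  rw [indicator_of_notMem hξ] at this
  simpa using this

lemma Good.m1 {S : Set (ℝ × ℝ)} {n m : ℤ} {f : ℝ × ℝ → ℂ}
    (h : Good S n m f) : Good S n m (M1 n f) := by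
  refine ⟨?_, fun ξ => ?_⟩
  · have := h.meas
    unfold M1
    fun_prop
  · by_cases hξ : ξ ∈ S ∩ cell n m
    · refine le_trans ?_ (h.bound ξ)
      have h1 := hξ.2.1
      rw [Int.floor_eq_iff] at h1
      unfold M1
      rw [norm_mul, norm_mul, Complex.norm_I, one_mul, Complex.norm_real]
      refine mul_le_of_le_one_left (norm_nonneg _) ?_
      rw [Real.norm_eq_abs, abs_le]
      constructor <;> linarith
    · unfold M1
      rw [h.zero_of_not hξ, mul_zero, norm_zero]
      exact indicator_nonneg (fun _ _ => zero_le_one) _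

lemma Good.m2 {S : Set (ℝ × ℝ)} {n m : ℤ} {f : ℝ × ℝ → ℂ}
    (h : Good S n m f) : Good S n m (M2 m f) := by
  refine ⟨?_, fun ξ => ?_⟩
  · have := h.meas
    unfold M2
    fun_prop
  · by_cases hξ : ξ ∈ S ∩ cell n m
    · refine le_trans ?_ (h.bound ξ)
      have h1 := hξ.2.2
      rw [Int.floor_eq_iff] at h1
      unfold M2
      rw [norm_mul, norm_mul, Complex.norm_I, one_mul, Complex.norm_real]
      refine mul_le_of_le_one_left (norm_nonneg _) ?_
      rw [Real.norm_eq_abs, abs_le]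
      constructor <;> linarith
    · unfold M2
      rw [h.zero_of_not hξ, mul_zero, norm_zero]
      exact indicator_nonneg (fun _ _ => zero_le_one) _

lemma Good.chi {S : Set (ℝ × ℝ)} (hS : MeasurableSet S) (n m : ℤ) :
    Good S n m (chi (S ∩ cell n m)) := by
  refine ⟨?_, fun ξ => ?_⟩
  · exact measurable_const.indicator (hS.inter (cell_measurable n m))
  · unfold _root_.chi
    rw [norm_indicator_eq_indicator_norm]
    simp

lemma Good.deriv1 {S : Set (ℝ × ℝ)} (hS : MeasurableSet S) {n m : ℤ} {f : ℝ × ℝ → ℂ}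
    (h : Good S n m f) (t x y : ℝ) :
    HasDerivAt (fun x => extOp f (t, x, y))
      (Complex.I * n * extOp f (t, x, y) + extOp (M1 n f) (t, x, y)) x := by
  have hi := h.integrable hS
  have hi1 := h.m1.integrable hS
  have e : (fun ξ : ℝ × ℝ => Complex.I * ξ.1 * f ξ) =
      fun ξ => (fun ξ => (Complex.I * n) * f ξ) ξ + M1 n f ξ := by
    ext ξ; simp only [M1]; push_cast; ring
  have := extOp_deriv1 hi (by rw [e]; exact (hi.const_mul _).add hi1) t x y
  rwa [e, extOp_add (hi.const_mul _) hi1, extOp_smul] at this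

lemma Good.deriv2 {S : Set (ℝ × ℝ)} (hS : MeasurableSet S) {n m : ℤ} {f : ℝ × ℝ → ℂ}
    (h : Good S n m f) (t x y : ℝ) :
    HasDerivAt (fun y => extOp f (t, x, y))
      (Complex.I * m * extOp f (t, x, y) + extOp (M2 m f) (t, x, y)) y := by
  have hi := h.integrable hS
  have hi1 := h.m2.integrable hS
  have e : (fun ξ : ℝ × ℝ => Complex.I * ξ.2 * f ξ) =
      fun ξ => (fun ξ => (Complex.I * m) * f ξ) ξ + M2 m f ξ := by
    ext ξ; simp only [M2]; push_cast; ring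
  have := extOp_deriv2 hi (by rw [e]; exact (hi.const_mul _).add hi1) t x y
  rwa [e, extOp_add (hi.const_mul _) hi1, extOp_smul] at this

lemma Good.eLpNorm_le {S : Set (ℝ × ℝ)} (hS : MeasurableSet S) {n m : ℤ} {f : ℝ × ℝ → ℂ}
    (h : Good S n m f) {r : ℝ} (hr : 0 < r) :
    eLpNorm f (ENNReal.ofReal r) volume ≤ volume (S ∩ cell n m) ^ (1 / r) := by
  have hm := hS.inter (cell_measurable n m)
  calc eLpNorm f (ENNReal.ofReal r) volume
      ≤ eLpNorm ((S ∩ cell n m).indicator (fun _ => (1 : ℝ))) (ENNReal.ofReal r) volume :=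
        eLpNorm_mono_real h.bound
    _ = _ := by
      rw [eLpNorm_indicator_const hm (by simpa using hr) ENNReal.ofReal_ne_top]
      simp [ENNReal.toReal_ofReal hr.le]

lemma lint_le_of_eLpNorm {α : Type*} [MeasurableSpace α] {μ : Measure α} {f : α → ℂ} {s : ℝ}
    (hs : 0 < s) {B : ℝ≥0∞} (h : eLpNorm f (ENNReal.ofReal s) μ ≤ B) :
    ∫⁻ x, ‖f x‖ₑ ^ s ∂μ ≤ B ^ s := by
  rw [eLpNorm_eq_lintegral_rpow_enorm_toReal (by simpa using hs) ENNReal.ofReal_ne_top,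
    ENNReal.toReal_ofReal hs.le] at h
  have := ENNReal.rpow_le_rpow h hs.le
  rwa [← ENNReal.rpow_mul, one_div_mul_cancel hs.ne', ENNReal.rpow_one] at this

lemma BH_good {s r A : ℝ} (hs : 0 < s) (hr : 0 < r) (hBH : BH s r A) {S : Set (ℝ × ℝ)}
    (hS : MeasurableSet S) {n m d e : ℤ} (hd : 2 ≤ |d|) (hd' : |d| ≤ 5) (he : 2 ≤ |e|)
    (he' : |e| ≤ 5)
    {f g : ℝ × ℝ → ℂ} (hf : Good S n m f) (hg : Good S (n + d) (m + e) g) :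
    ∫⁻ p, ‖extOp f p * extOp g p‖ₑ ^ s ≤ ENNReal.ofReal A ^ s *
      (volume (S ∩ cell n m) * volume (S ∩ cell (n + d) (m + e))) ^ (s / r) := by
  have hsupp : ∀ {n m : ℤ} {f : ℝ × ℝ → ℂ}, Good S n m f → Function.support f ⊆ unitSq n m := by
    intro n m f h ξ hξ
    by_contra hc
    exact hξ (h.zero_of_not fun h' => hc (cell_subset n m h'.2))
  have e1 : ((n : ℝ) - ((n + d : ℤ) : ℝ)) = ((-d : ℤ) : ℝ) := by push_cast; ring
  have e2 : ((m : ℝ) - ((m + e : ℤ) : ℝ)) = ((-e : ℤ) : ℝ) := by push_cast; ring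
  have := hBH n m (n + d : ℤ) (m + e : ℤ)
    (by rw [e1, ← Int.cast_abs, abs_neg]; exact_mod_cast hd)
    (by rw [e1, ← Int.cast_abs, abs_neg]; exact_mod_cast hd')
    (by rw [e2, ← Int.cast_abs, abs_neg]; exact_mod_cast he)
    (by rw [e2, ← Int.cast_abs, abs_neg]; exact_mod_cast he') f g (hsupp hf) (hsupp hg)
  refine (lint_le_of_eLpNorm hs this).trans ?_
  calc _ ≤ (ENNReal.ofReal A * volume (S ∩ cell n m) ^ (1 / r) *
        volume (S ∩ cell (n + d) (m + e)) ^ (1 / r)) ^ s := by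
        gcongr
        · exact hf.eLpNorm_le hS hr
        · exact hg.eLpNorm_le hS hr
    _ = _ := by
      rw [mul_assoc, ← ENNReal.mul_rpow_of_nonneg _ _ (by positivity),
        ENNReal.mul_rpow_of_nonneg _ _ hs.le, ← ENNReal.rpow_mul]
      congr 2; ring

lemma enorm_add_rpow {s : ℝ} (hs1 : 1 ≤ s) (hs2 : s ≤ 2) (a b : ℂ) :
    ‖a + b‖ₑ ^ s ≤ 2 * (‖a‖ₑ ^ s + ‖b‖ₑ ^ s) := by
  calc ‖a + b‖ₑ ^ s ≤ (‖a‖ₑ + ‖b‖ₑ) ^ s :=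
        ENNReal.rpow_le_rpow (enorm_add_le _ _) (by linarith)
    _ ≤ 2 ^ (s - 1) * (‖a‖ₑ ^ s + ‖b‖ₑ ^ s) := ENNReal.rpow_add_le_mul_rpow_add_rpow _ _ hs1
    _ ≤ _ := by
      gcongr
      calc (2 : ℝ≥0∞) ^ (s - 1) ≤ 2 ^ (1 : ℝ) :=
                ENNReal.rpow_le_rpow_of_exponent_le (by norm_num) (by linarith)
        _ = 2 := by simp

lemma lint_add_le {s : ℝ} (hs1 : 1 ≤ s) (hs2 : s ≤ 2) {F G : ℝ × ℝ × ℝ → ℂ}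
    (hF : Continuous F) {A B : ℝ≥0∞} (hA : ∫⁻ p, ‖F p‖ₑ ^ s ≤ A)
    (hB : ∫⁻ p, ‖G p‖ₑ ^ s ≤ B) : ∫⁻ p, ‖F p + G p‖ₑ ^ s ≤ 2 * (A + B) := by
  calc ∫⁻ p, ‖F p + G p‖ₑ ^ s ≤ ∫⁻ p, 2 * (‖F p‖ₑ ^ s + ‖G p‖ₑ ^ s) :=
        lintegral_mono fun p => enorm_add_rpow hs1 hs2 _ _
    _ = 2 * ((∫⁻ p, ‖F p‖ₑ ^ s) + ∫⁻ p, ‖G p‖ₑ ^ s) := by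
        rw [lintegral_const_mul' _ _ (by simp), lintegral_add_left (by fun_prop)]
    _ ≤ _ := by gcongr

/-- The bilinear estimate, summed over a grid of unit cells. -/
lemma unit_grid {s : ℝ} (hs1 : 1 ≤ s) (hs2 : s ≤ 2) : ∃ C : ℝ≥0∞, C ≠ ⊤ ∧
    ∀ (r A : ℝ), 0 < r → BH s r A → ∀ (S : Set (ℝ × ℝ)), MeasurableSet S →
    ∀ (N₁ N₂ : Finset ℤ) (d e : ℤ), 2 ≤ |d| → |d| ≤ 5 → 2 ≤ |e| → |e| ≤ 5 →
    ∫⁻ p, ‖∑ n ∈ N₁, ∑ m ∈ N₂, extOp (chi (S ∩ cell n m)) p *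
        extOp (chi (S ∩ cell (n + d) (m + e))) p‖ₑ ^ s ≤
      C * (ENNReal.ofReal A ^ s * ∑ n ∈ N₁, ∑ m ∈ N₂,
        (volume (S ∩ cell n m) * volume (S ∩ cell (n + d) (m + e))) ^ (s / r)) := by
  obtain ⟨C, hC, h⟩ := ortho2 hs1 hs2
  refine ⟨C * 25, ENNReal.mul_ne_top hC (by simp), ?_⟩
  intro r A hr hBH S hS N₁ N₂ d e hd hd' he he'
  set f : ℤ → ℤ → ℝ × ℝ → ℂ := fun n m => chi (S ∩ cell n m) with hf
  set g : ℤ → ℤ → ℝ × ℝ → ℂ := fun n m => chi (S ∩ cell (n + d) (m + e)) with hg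
  have gf : ∀ n m, Good S n m (f n m) := fun n m => Good.chi hS n m
  have gg : ∀ n m, Good S (n + d) (m + e) (g n m) := fun n m => Good.chi hS _ _
  have hc : ∀ {n m : ℤ} {f : ℝ × ℝ → ℂ}, Good S n m f → Continuous (extOp f) :=
    fun h => extOp_continuous (h.integrable hS)
  have hcm : ∀ {n m n' m' : ℤ} {f g : ℝ × ℝ → ℂ}, Good S n m f → Good S n' m' g →
      Continuous fun p => extOp f p * extOp g p := fun h h' => (hc h).mul (hc h')
  have key := h N₁ N₂ (fun n => 2 * n + d) (fun n => 2 * n + e)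
    (fun a _ b _ hab => by simpa using hab)
    (fun a _ b _ hab => by simpa using hab)
    (fun n m p => extOp (f n m) p * extOp (g n m) p)
    (fun n m p => extOp (M1 n (f n m)) p * extOp (g n m) p +
      extOp (f n m) p * extOp (M1 (n + d) (g n m)) p)
    (fun n m p => extOp (M2 m (f n m)) p * extOp (g n m) p +
      extOp (f n m) p * extOp (M2 (m + e) (g n m)) p)
    (fun n m p => (extOp (M2 m (M1 n (f n m))) p * extOp (g n m) p +
      extOp (M1 n (f n m)) p * extOp (M2 (m + e) (g n m)) p) +
      (extOp (M2 m (f n m)) p * extOp (M1 (n + d) (g n m)) p +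
      extOp (f n m) p * extOp (M2 (m + e) (M1 (n + d) (g n m))) p))
    (fun n m t x y => by
      refine (((gf n m).deriv1 hS t x y).mul ((gg n m).deriv1 hS t x y)).congr_deriv ?_
      push_cast; ring)
    (fun n m t x y => by
      refine (((gf n m).deriv2 hS t x y).mul ((gg n m).deriv2 hS t x y)).congr_deriv ?_
      push_cast; ring)
    (fun n m t x y => by
      refine ((((gf n m).m1.deriv2 hS t x y).mul ((gg n m).deriv2 hS t x y)).add
        (((gf n m).deriv2 hS t x y).mul ((gg n m).m1.deriv2 hS t x y))).congr_deriv ?_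
      push_cast; ring)
    (fun n m => hcm (gf n m) (gg n m))
    (fun n m => (hcm (gf n m).m1 (gg n m)).add (hcm (gf n m) (gg n m).m1))
    (fun n m => (hcm (gf n m).m2 (gg n m)).add (hcm (gf n m) (gg n m).m2))
    (fun n m => ((hcm (gf n m).m1.m2 (gg n m)).add (hcm (gf n m).m1 (gg n m).m2)).add
      ((hcm (gf n m).m2 (gg n m).m1).add (hcm (gf n m) (gg n m).m1.m2)))
  refine key.trans ?_
  rw [mul_assoc]
  refine mul_le_mul_right ?_ C
  rw [Finset.mul_sum, Finset.mul_sum]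
  refine Finset.sum_le_sum fun n _ => ?_
  rw [Finset.mul_sum, Finset.mul_sum]
  refine Finset.sum_le_sum fun m _ => ?_
  set V := ENNReal.ofReal A ^ s *
      (volume (S ∩ cell n m) * volume (S ∩ cell (n + d) (m + e))) ^ (s / r) with hV
  have hb : ∀ {f g : ℝ × ℝ → ℂ}, Good S n m f → Good S (n + d) (m + e) g →
      ∫⁻ p, ‖extOp f p * extOp g p‖ₑ ^ s ≤ V := fun hf hg =>
    BH_good (by linarith) hr hBH hS hd hd' he he' hf hg
  have b0 := hb (gf n m) (gg n m)
  have b1 := lint_add_le hs1 hs2 (hcm (gf n m).m1 (gg n m)) (hb (gf n m).m1 (gg n m))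
    (hb (gf n m) (gg n m).m1)
  have b2 := lint_add_le hs1 hs2 (hcm (gf n m).m2 (gg n m)) (hb (gf n m).m2 (gg n m))
    (hb (gf n m) (gg n m).m2)
  have b3 := lint_add_le hs1 hs2
    ((hcm (gf n m).m1.m2 (gg n m)).add (hcm (gf n m).m1 (gg n m).m2))
    (lint_add_le hs1 hs2 (hcm (gf n m).m1.m2 (gg n m)) (hb (gf n m).m1.m2 (gg n m))
      (hb (gf n m).m1 (gg n m).m2))
    (lint_add_le hs1 hs2 (hcm (gf n m).m2 (gg n m).m1) (hb (gf n m).m2 (gg n m).m1)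
      (hb (gf n m) (gg n m).m1.m2))
  refine (add_le_add (add_le_add (add_le_add b0 b1) b2) b3).trans (le_of_eq ?_)
  ring


/-- The anisotropic dilation of the plane. -/
def dil (a b : ℝ) : ℝ × ℝ → ℝ × ℝ := Prod.map (a * ·) (b * ·)

/-- The corresponding dilation of `ℝ³`. -/
def dil3 (a b : ℝ) : ℝ × ℝ × ℝ → ℝ × ℝ × ℝ := Prod.map ((a * b) * ·) (dil a b)

lemma dil_map {a b : ℝ} (ha : 0 < a) (hb : 0 < b) :
    Measure.map (dil a b) volume = ENNReal.ofReal (a * b)⁻¹ • volume := by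
  unfold dil
  rw [Measure.volume_eq_prod, ← Measure.map_prod_map _ _ (by fun_prop) (by fun_prop),
    Real.map_volume_mul_left ha.ne', Real.map_volume_mul_left hb.ne', Measure.prod_smul_left,
    Measure.prod_smul_right, smul_smul, ← ENNReal.ofReal_mul (by positivity),
    abs_of_pos (by positivity), abs_of_pos (by positivity), mul_inv]

lemma dil3_map {a b : ℝ} (ha : 0 < a) (hb : 0 < b) :
    Measure.map (dil3 a b) volume = ENNReal.ofReal ((a * b) ^ 2)⁻¹ • volume := by
  have hab : 0 < a * b := by positivity
  unfold dil3
  rw [Measure.volume_eq_prod, ← Measure.map_prod_map _ _ (by fun_prop)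
    (by unfold dil; fun_prop), dil_map ha hb,
    Real.map_volume_mul_left hab.ne', Measure.prod_smul_left,
    Measure.prod_smul_right, smul_smul, ← ENNReal.ofReal_mul (by positivity),
    abs_of_pos (by positivity), pow_two, mul_inv (a * b) (a * b)]

lemma dil_emb {a b : ℝ} (ha : 0 < a) (hb : 0 < b) : MeasurableEmbedding (dil a b) := by
  have := (Homeomorph.mulLeft₀ a ha.ne').prodCongr (Homeomorph.mulLeft₀ b hb.ne')
  exact ((Homeomorph.mulLeft₀ a ha.ne').prodCongr (Homeomorph.mulLeft₀ b hb.ne')).measurableEmbedding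

lemma dil3_emb {a b : ℝ} (ha : 0 < a) (hb : 0 < b) : MeasurableEmbedding (dil3 a b) :=
  ((Homeomorph.mulLeft₀ (a * b) (by positivity)).prodCongr
    ((Homeomorph.mulLeft₀ a ha.ne').prodCongr (Homeomorph.mulLeft₀ b hb.ne'))).measurableEmbedding

lemma extOp_dil {a b : ℝ} (ha : 0 < a) (hb : 0 < b) (f : ℝ × ℝ → ℂ) (p : ℝ × ℝ × ℝ) :
    extOp f (dil3 a b p) = ((a * b : ℝ) : ℂ)⁻¹ * extOp (fun ξ => f (dil a⁻¹ b⁻¹ ξ)) p := by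
  unfold extOp
  have h := (dil_emb ha hb).integral_map (μ := volume) (fun ξ : ℝ × ℝ =>
    Complex.exp (Complex.I * (p.1 * ξ.1 * ξ.2 + p.2.1 * ξ.1 + p.2.2 * ξ.2 : ℝ)) *
      f (dil a⁻¹ b⁻¹ ξ))
  rw [dil_map ha hb, integral_smul_measure, ENNReal.toReal_ofReal (by positivity)] at h
  have e : ((a * b : ℝ) : ℂ)⁻¹ = (((a * b)⁻¹ : ℝ) : ℂ) := by push_cast; rfl
  rw [e, ← Complex.real_smul, h]
  congr 1; ext ξ
  have : dil a⁻¹ b⁻¹ (dil a b ξ) = ξ := by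
    exact Prod.ext (inv_mul_cancel_left₀ ha.ne' _) (inv_mul_cancel_left₀ hb.ne' _)
  rw [this]
  simp only [dil3, dil, Prod.map]
  congr 4
  ring

/-- Cells of the grid with mesh `a⁻¹ × b⁻¹`. -/
def cs (a b : ℝ) (n m : ℤ) : Set (ℝ × ℝ) := {ξ | ⌊a * ξ.1⌋ = n ∧ ⌊b * ξ.2⌋ = m}

lemma cs_measurable (a b : ℝ) (n m : ℤ) : MeasurableSet (cs a b n m) := by
  have h1 : Measurable fun ξ : ℝ × ℝ => ⌊a * ξ.1⌋ := by fun_prop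
  have h2 : Measurable fun ξ : ℝ × ℝ => ⌊b * ξ.2⌋ := by fun_prop
  exact (h1 (measurableSet_singleton n)).inter (h2 (measurableSet_singleton m))

/-- The bilinear estimate, summed over a grid of rescaled cells. -/
lemma scaled_grid {s : ℝ} (hs1 : 1 ≤ s) (hs2 : s ≤ 2) : ∃ C : ℝ≥0∞, C ≠ ⊤ ∧
    ∀ (r A : ℝ), 0 < r → BH s r A → ∀ (S : Set (ℝ × ℝ)), MeasurableSet S →
    ∀ (a b : ℝ), 0 < a → 0 < b →
    ∀ (N₁ N₂ : Finset ℤ) (d e : ℤ), 2 ≤ |d| → |d| ≤ 5 → 2 ≤ |e| → |e| ≤ 5 →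
    ∫⁻ p, ‖∑ n ∈ N₁, ∑ m ∈ N₂, extOp (chi (S ∩ cs a b n m)) p *
        extOp (chi (S ∩ cs a b (n + d) (m + e))) p‖ₑ ^ s ≤
      C * (ENNReal.ofReal A ^ s * ENNReal.ofReal (a * b) ^ (2 - 2 * s + 2 * s / r) *
        ∑ n ∈ N₁, ∑ m ∈ N₂,
        (volume (S ∩ cs a b n m) * volume (S ∩ cs a b (n + d) (m + e))) ^ (s / r)) := by
  obtain ⟨C, hC, h⟩ := unit_grid hs1 hs2
  refine ⟨C, hC, ?_⟩
  intro r A hr hBH S hS a b ha hb N₁ N₂ d e hd hd' he he'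
  have hab : 0 < a * b := by positivity
  have hs0 : 0 ≤ s := by linarith
  set D := dil a⁻¹ b⁻¹ with hD
  have hDm : Measurable D := (dil_emb (inv_pos.2 ha) (inv_pos.2 hb)).measurable
  have hcell : ∀ n m, D ⁻¹' (S ∩ cs a b n m) = D ⁻¹' S ∩ cell n m := by
    intro n m
    rw [preimage_inter]
    congr 1
    ext ξ
    simp [cs, cell, hD, dil, ← mul_assoc, mul_inv_cancel₀ ha.ne', mul_inv_cancel₀ hb.ne']
  have hvol : ∀ n m, volume (D ⁻¹' S ∩ cell n m) =
      ENNReal.ofReal (a * b) * volume (S ∩ cs a b n m) := by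
    intro n m
    rw [← hcell, ← Measure.map_apply hDm (hS.inter (cs_measurable a b n m)), hD,
      dil_map (inv_pos.2 ha) (inv_pos.2 hb)]
    simp [mul_comm]
  have hext : ∀ n m p, extOp (chi (S ∩ cs a b n m)) (dil3 a b p) =
      ((a * b : ℝ) : ℂ)⁻¹ * extOp (chi (D ⁻¹' S ∩ cell n m)) p := by
    intro n m p
    rw [extOp_dil ha hb, ← hcell]
    rfl
  have h0 := h r A hr hBH (D ⁻¹' S) (hDm hS) N₁ N₂ d e hd hd' he he'
  simp only [hvol] at h0
  set w := ENNReal.ofReal (a * b) with hw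
  have hw0 : w ≠ 0 := by simp [hw, hab]
  have hwt : w ≠ ⊤ := ENNReal.ofReal_ne_top
  set F : ℝ × ℝ × ℝ → ℂ := fun p => ∑ n ∈ N₁, ∑ m ∈ N₂, extOp (chi (S ∩ cs a b n m)) p *
        extOp (chi (S ∩ cs a b (n + d) (m + e))) p with hF
  have hFd : ∀ p, F (dil3 a b p) = (((a * b : ℝ) : ℂ)⁻¹) ^ 2 *
    ∑ n ∈ N₁, ∑ m ∈ N₂, extOp (chi (D ⁻¹' S ∩ cell n m)) p *
        extOp (chi (D ⁻¹' S ∩ cell (n + d) (m + e))) p := by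
    intro p
    simp only [hF, hext, Finset.mul_sum]
    refine Finset.sum_congr rfl fun n _ => Finset.sum_congr rfl fun m _ => ?_
    ring
  have hen : ‖(((a * b : ℝ) : ℂ)⁻¹) ^ 2‖ₑ ^ s = w ^ (-2 * s) := by
    rw [enorm_pow, enorm_inv (by exact_mod_cast hab.ne')]
    have : ‖((a * b : ℝ) : ℂ)‖ₑ = w := by
      rw [← ofReal_norm, Complex.norm_real, Real.norm_eq_abs, abs_of_pos hab]
    rw [this, ← ENNReal.rpow_natCast, ← ENNReal.rpow_neg_one,
      ← ENNReal.rpow_mul, ← ENNReal.rpow_mul]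
    congr 1; push_cast; ring
  have h1 : ENNReal.ofReal ((a * b) ^ 2)⁻¹ * ∫⁻ p, ‖F p‖ₑ ^ s =
      ∫⁻ p, ‖F (dil3 a b p)‖ₑ ^ s := by
    have := (dil3_emb ha hb).lintegral_map (μ := volume) (fun p => ‖F p‖ₑ ^ s)
    rw [← this, dil3_map ha hb, lintegral_smul_measure, smul_eq_mul]
  have hw2 : ENNReal.ofReal ((a * b) ^ 2)⁻¹ = w ^ (-2 : ℝ) := by
    rw [ENNReal.ofReal_inv_of_pos (by positivity), ENNReal.ofReal_pow hab.le, ENNReal.rpow_neg]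
    simp [hw]
  have h2 : ∫⁻ p, ‖F p‖ₑ ^ s = w ^ (2 : ℝ) * ∫⁻ p, ‖F (dil3 a b p)‖ₑ ^ s := by
    rw [← h1, hw2, ← mul_assoc, ← ENNReal.rpow_add _ _ hw0 hwt]; simp
  rw [h2]
  simp only [hFd, enorm_mul, ENNReal.mul_rpow_of_nonneg _ _ hs0, hen]
  rw [lintegral_const_mul' _ _ (by simp [hw0, hwt])]
  calc _ ≤ w ^ (2 : ℝ) * (w ^ (-2 * s) * (C * (ENNReal.ofReal A ^ s * ∑ n ∈ N₁, ∑ m ∈ N₂,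
        (w * volume (S ∩ cs a b n m) * (w * volume (S ∩ cs a b (n + d) (m + e)))) ^ (s / r)))) := by
        gcongr
    _ = _ := by
      have e1 : ∀ u v : ℝ≥0∞, (w * u * (w * v)) ^ (s / r) = w ^ (2 * s / r) * (u * v) ^ (s / r) := by
        intro u v
        have hsr : 0 ≤ s / r := by positivity
        rw [show w * u * (w * v) = (w * w) * (u * v) by ring,
          ENNReal.mul_rpow_of_nonneg _ _ hsr, ENNReal.mul_rpow_of_nonneg w w hsr,
          ← ENNReal.rpow_add _ _ hw0 hwt]
        congr 2; ring
      simp only [e1, ← Finset.mul_sum]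
      rw [show 2 - 2 * s + 2 * s / r = 2 + (-2 * s) + 2 * s / r by ring,
        ENNReal.rpow_add _ _ hw0 hwt, ENNReal.rpow_add _ _ hw0 hwt]
      ring

lemma cs_sum_le (a b : ℝ) {S : Set (ℝ × ℝ)} (hS : MeasurableSet S) (N₁ N₂ : Finset ℤ) (d e : ℤ) :
    ∑ n ∈ N₁, ∑ m ∈ N₂, volume (S ∩ cs a b (n + d) (m + e)) ≤ volume S := by
  rw [← Finset.sum_product', ← measure_biUnion_finset]
  · exact measure_mono (iUnion₂_subset fun _ _ => inter_subset_left)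
  · rintro ⟨n, m⟩ _ ⟨n', m'⟩ _ hne
    rw [Function.onFun, Set.disjoint_left]
    rintro ξ ⟨_, h1, h2⟩ ⟨_, h1', h2'⟩
    apply hne
    simp only [Prod.mk.injEq]
    constructor <;> simp_all
  · exact fun _ _ => hS.inter (cs_measurable a b _ _)

/-- Rescaled grid estimate in terms of the largest cell measure. -/
lemma scaled_grid_max {s : ℝ} (hs1 : 1 ≤ s) (hs2 : s ≤ 2) : ∃ C : ℝ≥0∞, C ≠ ⊤ ∧
    ∀ (r A : ℝ), 0 < r → 1 ≤ 2 * s / r → BH s r A → ∀ (S : Set (ℝ × ℝ)), MeasurableSet S →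
    ∀ (a b : ℝ), 0 < a → 0 < b → ∀ M : ℝ≥0∞, (∀ n m, volume (S ∩ cs a b n m) ≤ M) →
    ∀ (N₁ N₂ : Finset ℤ) (d e : ℤ), 2 ≤ |d| → |d| ≤ 5 → 2 ≤ |e| → |e| ≤ 5 →
    ∫⁻ p, ‖∑ n ∈ N₁, ∑ m ∈ N₂, extOp (chi (S ∩ cs a b n m)) p *
        extOp (chi (S ∩ cs a b (n + d) (m + e))) p‖ₑ ^ s ≤
      C * (ENNReal.ofReal A ^ s * ENNReal.ofReal (a * b) ^ (2 - 2 * s + 2 * s / r) *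
        (M ^ (2 * s / r - 1) * volume S)) := by
  obtain ⟨C, hC, h⟩ := scaled_grid hs1 hs2
  refine ⟨C * 2, ENNReal.mul_ne_top hC (by simp), ?_⟩
  intro r A hr hsr hBH S hS a b ha hb M hM N₁ N₂ d e hd hd' he he'
  refine (h r A hr hBH S hS a b ha hb N₁ N₂ d e hd hd' he he').trans ?_
  rw [mul_assoc C 2, mul_left_comm 2]
  gcongr
  have hpt : ∀ u v : ℝ≥0∞, u ≤ M → v ≤ M → (u * v) ^ (s / r) ≤ M ^ (2 * s / r - 1) * (u + v) := by
    have hmax : ∀ u v : ℝ≥0∞, u ≤ v → v ≤ M → (u * v) ^ (s / r) ≤ M ^ (2 * s / r - 1) * v := by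
      intro u v huv hv
      calc (u * v) ^ (s / r) ≤ (v * v) ^ (s / r) := by gcongr
        _ = v ^ (2 * s / r) := by
          rw [← pow_two, ← ENNReal.rpow_natCast, ← ENNReal.rpow_mul]; congr 1; push_cast; ring
        _ = v ^ (2 * s / r - 1) * v := by
          conv_rhs => rw [← ENNReal.rpow_one v, ← ENNReal.rpow_mul]
          rw [← ENNReal.rpow_add_of_nonneg _ _ (by linarith) zero_le_one]
          congr 1; ring
        _ ≤ _ := by
          gcongr
    intro u v hu hv
    rcases le_total u v with huv | huv
    · exact (hmax u v huv hv).trans (by gcongr; exact le_add_self)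
    · rw [mul_comm u v]
      exact (hmax v u huv hu).trans (by gcongr; exact le_self_add)
  calc ∑ n ∈ N₁, ∑ m ∈ N₂,
        (volume (S ∩ cs a b n m) * volume (S ∩ cs a b (n + d) (m + e))) ^ (s / r)
      ≤ ∑ n ∈ N₁, ∑ m ∈ N₂, M ^ (2 * s / r - 1) *
        (volume (S ∩ cs a b n m) + volume (S ∩ cs a b (n + d) (m + e))) := by
        refine Finset.sum_le_sum fun n _ => Finset.sum_le_sum fun m _ => hpt _ _ (hM _ _) (hM _ _)
    _ = M ^ (2 * s / r - 1) * (∑ n ∈ N₁, ∑ m ∈ N₂, volume (S ∩ cs a b (n + 0) (m + 0)) +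
          ∑ n ∈ N₁, ∑ m ∈ N₂, volume (S ∩ cs a b (n + d) (m + e))) := by
        simp only [← Finset.mul_sum, Finset.sum_add_distrib, add_zero]
    _ ≤ M ^ (2 * s / r - 1) * (volume S + volume S) := by
        gcongr
        · exact cs_sum_le a b hS N₁ N₂ 0 0
        · exact cs_sum_le a b hS N₁ N₂ d e
    _ = _ := by ring


/-- Two integers are far apart when they differ by at least two. -/
def far (n n' : ℤ) : Prop := n + 2 ≤ n' ∨ n' + 2 ≤ n

instance (n n' : ℤ) : Decidable (far n n') := by unfold far; infer_instance

/-- The Whitney relation: far apart, but with parents not far apart. -/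
def wh (n n' : ℤ) : Prop := far n n' ∧ ¬ far (n / 2) (n' / 2)

instance (n n' : ℤ) : Decidable (wh n n') := by unfold wh; infer_instance

/-- The Whitney weight at scale `2^(-(j+1))`. -/
noncomputable def W (j : ℕ) (x y : ℝ) : ℂ :=
  if wh ⌊(2 : ℝ) ^ (j + 1) * x⌋ ⌊(2 : ℝ) ^ (j + 1) * y⌋ then 1 else 0

lemma floor_half (J : ℕ) (x : ℝ) : ⌊(2 : ℝ) ^ (J + 1) * x⌋ / 2 = ⌊(2 : ℝ) ^ J * x⌋ := by
  have h := Int.floor_div_natCast ((2 : ℝ) ^ (J + 1) * x) 2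
  have e : (2 : ℝ) ^ (J + 1) * x / ((2 : ℕ) : ℝ) = 2 ^ J * x := by push_cast; ring
  rw [e] at h
  exact_mod_cast h.symm

lemma W_sum {x y : ℝ} (hx : x ∈ Icc (0 : ℝ) 1) (hy : y ∈ Icc (0 : ℝ) 1) (J : ℕ) :
    ∑ j ∈ Finset.range J, W j x y =
      if far ⌊(2 : ℝ) ^ J * x⌋ ⌊(2 : ℝ) ^ J * y⌋ then 1 else 0 := by
  induction J with
  | zero =>
    have h1 : 0 ≤ ⌊x⌋ := Int.floor_nonneg.2 hx.1
    have h2 : 0 ≤ ⌊y⌋ := Int.floor_nonneg.2 hy.1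
    have h3 : ⌊x⌋ ≤ 1 := by exact_mod_cast (Int.floor_le x).trans hx.2
    have h4 : ⌊y⌋ ≤ 1 := by exact_mod_cast (Int.floor_le y).trans hy.2
    simp only [Finset.range_zero, Finset.sum_empty, pow_zero, one_mul]
    rw [if_neg]
    unfold far; omega
  | succ J ih =>
    rw [Finset.sum_range_succ, ih, W, ← floor_half J x, ← floor_half J y]
    generalize ⌊(2 : ℝ) ^ (J + 1) * x⌋ = n
    generalize ⌊(2 : ℝ) ^ (J + 1) * y⌋ = n'
    by_cases h1 : far (n / 2) (n' / 2) <;> by_cases h2 : far n n'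
    · simp [wh, h1, h2]
    · exfalso; unfold far at h1 h2; omega
    · simp [wh, h1, h2]
    · simp [wh, h1, h2]

lemma W_tendsto {x y : ℝ} (hx : x ∈ Icc (0 : ℝ) 1) (hy : y ∈ Icc (0 : ℝ) 1) (hxy : x ≠ y) :
    Filter.Tendsto (fun J => ∑ j ∈ Finset.range J, W j x y) Filter.atTop (nhds 1) := by
  apply tendsto_const_nhds.congr'
  have hpos : 0 < |x - y| := abs_pos.2 (sub_ne_zero.2 hxy)
  have ht : Filter.Tendsto (fun J : ℕ => (2 : ℝ) ^ J * |x - y|) Filter.atTop Filter.atTop :=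
    (tendsto_pow_atTop_atTop_of_one_lt (by norm_num)).atTop_mul_const hpos
  filter_upwards [ht.eventually_ge_atTop 3] with J hJ
  rw [W_sum hx hy, if_pos]
  have hp : (0 : ℝ) < 2 ^ J := by positivity
  have hJ' : 3 ≤ |(2 : ℝ) ^ J * x - 2 ^ J * y| := by
    rw [← mul_sub, abs_mul, abs_of_pos hp]; exact hJ
  have a1 := Int.floor_le ((2 : ℝ) ^ J * x)
  have a2 := Int.lt_floor_add_one ((2 : ℝ) ^ J * x)
  have b1 := Int.floor_le ((2 : ℝ) ^ J * y)
  have b2 := Int.lt_floor_add_one ((2 : ℝ) ^ J * y)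
  unfold far
  rcases le_abs.1 hJ' with h | h
  · right
    have : (⌊(2 : ℝ) ^ J * y⌋ : ℝ) + 1 < ⌊(2 : ℝ) ^ J * x⌋ := by linarith
    have : ⌊(2 : ℝ) ^ J * y⌋ + 1 < ⌊(2 : ℝ) ^ J * x⌋ := by exact_mod_cast this
    omega
  · left
    have : (⌊(2 : ℝ) ^ J * x⌋ : ℝ) + 1 < ⌊(2 : ℝ) ^ J * y⌋ := by linarith
    have : ⌊(2 : ℝ) ^ J * x⌋ + 1 < ⌊(2 : ℝ) ^ J * y⌋ := by exact_mod_cast this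
    omega

lemma W_sum_norm {x y : ℝ} (hx : x ∈ Icc (0 : ℝ) 1) (hy : y ∈ Icc (0 : ℝ) 1) (J : ℕ) :
    ‖∑ j ∈ Finset.range J, W j x y‖ ≤ 1 := by
  rw [W_sum hx hy]; split_ifs <;> simp

lemma W_measurable (j : ℕ) {α : Type*} [MeasurableSpace α] {f g : α → ℝ} (hf : Measurable f)
    (hg : Measurable g) : Measurable fun z => W j (f z) (g z) := by
  have h : Measurable fun z => (⌊(2 : ℝ) ^ (j + 1) * f z⌋, ⌊(2 : ℝ) ^ (j + 1) * g z⌋) := by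
    fun_prop
  have h2 : Measurable fun q : ℤ × ℤ => (if wh q.1 q.2 then (1 : ℂ) else 0) :=
    measurable_of_countable _
  exact h2.comp h

/-- The admissible offsets. -/
def Dset : Finset ℤ := {-3, -2, 2, 3}

/-- The admissible cells for a given offset. -/
noncomputable def Nd (j : ℕ) (d : ℤ) : Finset ℤ := (Finset.Icc 0 (2 ^ (j + 1))).filter fun n => wh n (n + d)

lemma Nd_sum {j : ℕ} {n n' : ℤ} (hn : n ∈ Finset.Icc (0 : ℤ) (2 ^ (j + 1))) :
    ∑ d ∈ Dset, ∑ i ∈ Nd j d, ((if n = i then (1 : ℂ) else 0) * if n' = i + d then 1 else 0) =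
      if wh n n' then 1 else 0 := by
  have h1 : ∀ d, ∑ i ∈ Nd j d, ((if n = i then (1 : ℂ) else 0) * if n' = i + d then 1 else 0) =
      if wh n (n + d) ∧ n' = n + d then 1 else 0 := by
    intro d
    have : ∀ i, ((if n = i then (1 : ℂ) else 0) * if n' = i + d then 1 else 0) =
        if n = i then (if n' = n + d then 1 else 0) else 0 := by
      intro i; split_ifs <;> simp_all
    simp only [this, Finset.sum_ite_eq, Nd, Finset.mem_filter, hn, true_and]
    split_ifs <;> simp_all
  simp only [h1, Dset]
  rw [Finset.sum_insert (by decide), Finset.sum_insert (by decide), Finset.sum_insert (by decide),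
    Finset.sum_singleton]
  clear h1 hn
  split_ifs <;> first | (norm_num; done) | (exfalso; simp only [wh, far] at *; omega)

/-- The phase factor. -/
noncomputable def ph (p : ℝ × ℝ × ℝ) (ξ : ℝ × ℝ) : ℂ :=
  Complex.exp (Complex.I * (p.1 * ξ.1 * ξ.2 + p.2.1 * ξ.1 + p.2.2 * ξ.2 : ℝ))

/-- The piece of the square of the extension at scales `(j, k)`. -/
noncomputable def Fjk (S : Set (ℝ × ℝ)) (j k : ℕ) (p : ℝ × ℝ × ℝ) : ℂ :=
  ∑ d ∈ Dset, ∑ e ∈ Dset, ∑ n ∈ Nd j d, ∑ m ∈ Nd k e,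
    extOp (chi (S ∩ cs (2 ^ (j + 1)) (2 ^ (k + 1)) n m)) p *
      extOp (chi (S ∩ cs (2 ^ (j + 1)) (2 ^ (k + 1)) (n + d) (m + e))) p

lemma chi_integrable {S : Set (ℝ × ℝ)} (hS : MeasurableSet S) (hf : volume S ≠ ⊤) :
    Integrable (chi S) := by
  unfold chi
  exact (integrable_indicator_iff hS).2 (integrableOn_const hf)

lemma ph_chi_integrable {S : Set (ℝ × ℝ)} (hS : MeasurableSet S) (hf : volume S ≠ ⊤)
    (p : ℝ × ℝ × ℝ) : Integrable (fun ξ => ph p ξ * chi S ξ) :=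
  phase_integrable (chi_integrable hS hf) p

lemma chi_cs (S : Set (ℝ × ℝ)) (a b : ℝ) (n m : ℤ) (ξ : ℝ × ℝ) :
    chi (S ∩ cs a b n m) ξ = chi S ξ * (if ⌊a * ξ.1⌋ = n then 1 else 0) *
      (if ⌊b * ξ.2⌋ = m then 1 else 0) := by
  by_cases h : ξ ∈ S <;> by_cases h1 : ⌊a * ξ.1⌋ = n <;> by_cases h2 : ⌊b * ξ.2⌋ = m <;>
    simp [chi, cs, h, h1, h2]

lemma floor_mem {j : ℕ} {x : ℝ} (hx : x ∈ Icc (0 : ℝ) 1) :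
    ⌊(2 : ℝ) ^ (j + 1) * x⌋ ∈ Finset.Icc (0 : ℤ) (2 ^ (j + 1)) := by
  rw [Finset.mem_Icc]
  have hp : (0 : ℝ) < 2 ^ (j + 1) := by positivity
  refine ⟨Int.floor_nonneg.2 (mul_nonneg hp.le hx.1), ?_⟩
  have : ((⌊(2 : ℝ) ^ (j + 1) * x⌋ : ℤ) : ℝ) ≤ 2 ^ (j + 1) :=
    (Int.floor_le _).trans (by nlinarith [hx.2])
  exact_mod_cast this

lemma Fjk_pt {S : Set (ℝ × ℝ)} (hS1 : S ⊆ Icc 0 1 ×ˢ Icc 0 1) (j k : ℕ)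
    (p : ℝ × ℝ × ℝ) (z : (ℝ × ℝ) × (ℝ × ℝ)) :
    ∑ d ∈ Dset, ∑ e ∈ Dset, ∑ n ∈ Nd j d, ∑ m ∈ Nd k e,
      (ph p z.1 * chi (S ∩ cs (2 ^ (j + 1)) (2 ^ (k + 1)) n m) z.1) *
      (ph p z.2 * chi (S ∩ cs (2 ^ (j + 1)) (2 ^ (k + 1)) (n + d) (m + e)) z.2) =
    (ph p z.1 * chi S z.1) * (ph p z.2 * chi S z.2) *
      (W j z.1.1 z.2.1 * W k z.1.2 z.2.2) := by
  by_cases h1 : z.1 ∈ S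
  swap
  · have : ∀ T, chi (S ∩ T) z.1 = 0 := fun T => by simp [chi, h1]
    simp [this]
    left; left; right; simp [chi, h1]
  have hz1 := hS1 h1
  have e1 := Nd_sum (n' := ⌊(2 : ℝ) ^ (j + 1) * z.2.1⌋) (floor_mem (j := j) hz1.1)
  have e2 := Nd_sum (n' := ⌊(2 : ℝ) ^ (k + 1) * z.2.2⌋) (floor_mem (j := k) hz1.2)
  rw [W, W, ← e1, ← e2, Finset.sum_mul_sum]
  simp only [Finset.sum_mul_sum]
  simp only [Finset.mul_sum, chi_cs]
  refine Finset.sum_congr rfl fun d _ => Finset.sum_congr rfl fun e _ =>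
    Finset.sum_congr rfl fun n _ => Finset.sum_congr rfl fun m _ => ?_
  ring

lemma Fjk_eq {S : Set (ℝ × ℝ)} (hS : MeasurableSet S) (hf : volume S ≠ ⊤)
    (hS1 : S ⊆ Icc 0 1 ×ˢ Icc 0 1) (j k : ℕ) (p : ℝ × ℝ × ℝ) :
    Fjk S j k p = ∫ z : (ℝ × ℝ) × (ℝ × ℝ), (ph p z.1 * chi S z.1) * (ph p z.2 * chi S z.2) *
      (W j z.1.1 z.2.1 * W k z.1.2 z.2.2) ∂(volume.prod volume) := by
  have hI : ∀ n m, Integrable (fun ξ => ph p ξ *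
      chi (S ∩ cs (2 ^ (j + 1)) (2 ^ (k + 1)) n m) ξ) := fun n m =>
    ph_chi_integrable (hS.inter (cs_measurable _ _ _ _))
      ((measure_mono inter_subset_left).trans_lt hf.lt_top).ne p
  simp only [← Fjk_pt hS1]
  have hI2 : ∀ n m n' m', Integrable (fun z : (ℝ × ℝ) × (ℝ × ℝ) =>
      (ph p z.1 * chi (S ∩ cs (2 ^ (j + 1)) (2 ^ (k + 1)) n m) z.1) *
      (ph p z.2 * chi (S ∩ cs (2 ^ (j + 1)) (2 ^ (k + 1)) n' m') z.2)) (volume.prod volume) :=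
    fun n m n' m' => (hI n m).mul_prod (hI n' m')
  unfold Fjk
  rw [integral_finsetSum]
  swap
  · exact fun d _ => integrable_finsetSum _ fun e _ => integrable_finsetSum _ fun n _ =>
      integrable_finsetSum _ fun m _ => hI2 _ _ _ _
  refine Finset.sum_congr rfl fun d _ => ?_
  rw [integral_finsetSum]
  swap
  · exact fun e _ => integrable_finsetSum _ fun n _ =>
      integrable_finsetSum _ fun m _ => hI2 _ _ _ _
  refine Finset.sum_congr rfl fun e _ => ?_
  rw [integral_finsetSum]
  swap
  · exact fun n _ => integrable_finsetSum _ fun m _ => hI2 _ _ _ _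
  refine Finset.sum_congr rfl fun n _ => ?_
  rw [integral_finsetSum]
  swap
  · exact fun m _ => hI2 _ _ _ _
  refine Finset.sum_congr rfl fun m _ => ?_
  exact (integral_prod_mul (fun ξ => ph p ξ * chi (S ∩ cs (2 ^ (j + 1)) (2 ^ (k + 1)) n m) ξ)
    (fun ξ => ph p ξ * chi (S ∩ cs (2 ^ (j + 1)) (2 ^ (k + 1)) (n + d) (m + e)) ξ)).symm

lemma ae_ne : ∀ᵐ z : (ℝ × ℝ) × (ℝ × ℝ) ∂(volume.prod volume),
    z.1.1 ≠ z.2.1 ∧ z.1.2 ≠ z.2.2 := by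
  have hm : MeasurableSet {z : (ℝ × ℝ) × (ℝ × ℝ) | z.1.1 ≠ z.2.1 ∧ z.1.2 ≠ z.2.2} := by
    apply MeasurableSet.inter
    · exact (measurableSet_eq_fun (by fun_prop) (by fun_prop)).compl
    · exact (measurableSet_eq_fun (by fun_prop) (by fun_prop)).compl
  rw [Measure.ae_prod_iff_ae_ae hm]
  refine Filter.Eventually.of_forall fun ξ => ?_
  have hm2 : MeasurableSet {η : ℝ × ℝ | ξ.1 ≠ η.1 ∧ ξ.2 ≠ η.2} := by
    apply MeasurableSet.inter
    · exact (measurableSet_eq_fun (by fun_prop) (by fun_prop)).compl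
    · exact (measurableSet_eq_fun (by fun_prop) (by fun_prop)).compl
  rw [Measure.volume_eq_prod]
  rw [Measure.ae_prod_iff_ae_ae hm2]
  have h0 : ∀ c : ℝ, ∀ᵐ x : ℝ, c ≠ x := fun c => by
    filter_upwards [compl_mem_ae_iff.2 (measure_singleton c)] with x hx using fun h => hx h.symm
  filter_upwards [h0 ξ.1] with x hx
  filter_upwards [h0 ξ.2] with y hy using ⟨hx, hy⟩

lemma Fjk_tendsto {S : Set (ℝ × ℝ)} (hS : MeasurableSet S) (hf : volume S ≠ ⊤)
    (hS1 : S ⊆ Icc 0 1 ×ˢ Icc 0 1) (p : ℝ × ℝ × ℝ) :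
    Filter.Tendsto (fun J => ∑ j ∈ Finset.range J, ∑ k ∈ Finset.range J, Fjk S j k p)
      Filter.atTop (nhds (extOp (chi S) p * extOp (chi S) p)) := by
  have hI := ph_chi_integrable hS hf p
  have hP : Integrable (fun z : (ℝ × ℝ) × (ℝ × ℝ) =>
      (ph p z.1 * chi S z.1) * (ph p z.2 * chi S z.2)) (volume.prod volume) := hI.mul_prod hI
  have hmW : ∀ j k, Measurable fun z : (ℝ × ℝ) × (ℝ × ℝ) =>
      (W j z.1.1 z.2.1 * W k z.1.2 z.2.2) := fun j k =>
    (W_measurable j (by fun_prop) (by fun_prop)).mul (W_measurable k (by fun_prop) (by fun_prop))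
  have hWb : ∀ j x y, ‖W j x y‖ ≤ 1 := fun j x y => by unfold W; split_ifs <;> simp
  have hPW : ∀ j k, Integrable (fun z : (ℝ × ℝ) × (ℝ × ℝ) =>
      (ph p z.1 * chi S z.1) * (ph p z.2 * chi S z.2) *
      (W j z.1.1 z.2.1 * W k z.1.2 z.2.2)) (volume.prod volume) := fun j k => by
    refine hP.mul_bdd (c := 1) (hmW j k).aestronglyMeasurable (Filter.Eventually.of_forall fun z => ?_)
    rw [norm_mul]; exact mul_le_one₀ (hWb _ _ _) (norm_nonneg _) (hWb _ _ _)
  have e0 : extOp (chi S) p * extOp (chi S) p = ∫ z : (ℝ × ℝ) × (ℝ × ℝ),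
      (ph p z.1 * chi S z.1) * (ph p z.2 * chi S z.2) ∂(volume.prod volume) :=
    (integral_prod_mul (fun ξ => ph p ξ * chi S ξ) (fun ξ => ph p ξ * chi S ξ)).symm
  have e1 : ∀ J, ∑ j ∈ Finset.range J, ∑ k ∈ Finset.range J, Fjk S j k p =
      ∫ z : (ℝ × ℝ) × (ℝ × ℝ), (ph p z.1 * chi S z.1) * (ph p z.2 * chi S z.2) *
      ((∑ j ∈ Finset.range J, W j z.1.1 z.2.1) * ∑ k ∈ Finset.range J, W k z.1.2 z.2.2)
        ∂(volume.prod volume) := by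
    intro J
    simp only [Finset.sum_mul_sum]
    simp only [Finset.mul_sum]
    rw [integral_finsetSum]
    swap
    · exact fun j _ => integrable_finsetSum _ fun k _ => hPW j k
    refine Finset.sum_congr rfl fun j _ => ?_
    rw [integral_finsetSum]
    swap
    · exact fun k _ => hPW j k
    exact Finset.sum_congr rfl fun k _ => Fjk_eq hS hf hS1 j k p
  simp only [e0, e1]
  have hzero : ∀ z : (ℝ × ℝ) × (ℝ × ℝ), ¬ (z.1 ∈ S ∧ z.2 ∈ S) →
      (ph p z.1 * chi S z.1) * (ph p z.2 * chi S z.2) = 0 := by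
    intro z hz
    by_cases h : z.1 ∈ S
    · have : z.2 ∉ S := fun h' => hz ⟨h, h'⟩
      simp [chi, this]
    · simp [chi, h]
  refine tendsto_integral_of_dominated_convergence _ ?_ hP.norm ?_ ?_
  · intro J
    refine hP.aestronglyMeasurable.mul (Measurable.aestronglyMeasurable ?_)
    exact (Finset.measurable_fun_sum _ fun j _ => W_measurable j (by fun_prop) (by fun_prop)).mul
      (Finset.measurable_fun_sum _ fun j _ => W_measurable j (by fun_prop) (by fun_prop))
  · intro J
    refine Filter.Eventually.of_forall fun z => ?_
    by_cases hz : z.1 ∈ S ∧ z.2 ∈ S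
    · have h1 := hS1 hz.1
      have h2 := hS1 hz.2
      rw [norm_mul]
      refine mul_le_of_le_one_right (norm_nonneg _) ?_
      rw [norm_mul]
      exact mul_le_one₀ (W_sum_norm h1.1 h2.1 J) (norm_nonneg _) (W_sum_norm h1.2 h2.2 J)
    · rw [hzero z hz]; simp
  · filter_upwards [ae_ne] with z hne
    by_cases hz : z.1 ∈ S ∧ z.2 ∈ S
    · have h1 := hS1 hz.1
      have h2 := hS1 hz.2
      have := ((W_tendsto h1.1 h2.1 hne.1).mul (W_tendsto h1.2 h2.2 hne.2)).const_mul
        ((ph p z.1 * chi S z.1) * (ph p z.2 * chi S z.2))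
      simpa using this
    · rw [hzero z hz]; simp

lemma Fjk_inner_continuous {S : Set (ℝ × ℝ)} (hS : MeasurableSet S) (hf : volume S ≠ ⊤)
    (a b : ℝ) (N₁ N₂ : Finset ℤ) (d e : ℤ) :
    Continuous fun p => ∑ n ∈ N₁, ∑ m ∈ N₂, extOp (chi (S ∩ cs a b n m)) p *
      extOp (chi (S ∩ cs a b (n + d) (m + e))) p := by
  have h : ∀ n m, Continuous (extOp (chi (S ∩ cs a b n m))) := fun n m =>
    extOp_continuous (chi_integrable (hS.inter (cs_measurable _ _ _ _))
      ((measure_mono inter_subset_left).trans_lt hf.lt_top).ne)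
  exact continuous_finsetSum _ fun n _ => continuous_finsetSum _ fun m _ => (h _ _).mul (h _ _)

lemma Fjk_continuous {S : Set (ℝ × ℝ)} (hS : MeasurableSet S) (hf : volume S ≠ ⊤) (j k : ℕ) :
    Continuous (Fjk S j k) := by
  unfold Fjk
  exact continuous_finsetSum _ fun d _ => continuous_finsetSum _ fun e _ =>
    Fjk_inner_continuous hS hf _ _ _ _ _ _

lemma sq_norm_le {s : ℝ} (hs : 1 ≤ s) {S : Set (ℝ × ℝ)} (hS : MeasurableSet S)
    (hf : volume S ≠ ⊤) (hS1 : S ⊆ Icc 0 1 ×ˢ Icc 0 1) :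
    eLpNorm (fun p => extOp (chi S) p * extOp (chi S) p) (ENNReal.ofReal s) volume ≤
      ∑' j, ∑' k, eLpNorm (Fjk S j k) (ENNReal.ofReal s) volume := by
  have h1 : (1 : ℝ≥0∞) ≤ ENNReal.ofReal s := by simpa using hs
  have hm : ∀ j k, AEStronglyMeasurable (Fjk S j k) volume := fun j k =>
    (Fjk_continuous hS hf j k).aestronglyMeasurable
  have hm2 : ∀ j J, AEStronglyMeasurable (∑ k ∈ Finset.range J, Fjk S j k) volume := fun j J =>
    Finset.aestronglyMeasurable_sum _ fun k _ => hm j k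
  refine (Lp.eLpNorm_lim_le_liminf_eLpNorm (f := fun J => ∑ j ∈ Finset.range J,
    ∑ k ∈ Finset.range J, Fjk S j k) ?_ _ ?_).trans ?_
  · exact fun J => Finset.aestronglyMeasurable_sum _ fun j _ => hm2 j J
  · refine Filter.Eventually.of_forall fun p => ?_
    simpa using Fjk_tendsto hS hf hS1 p
  · refine Filter.liminf_le_of_frequently_le' (Filter.Eventually.frequently
      (Filter.Eventually.of_forall fun J => ?_))
    refine (eLpNorm_sum_le (fun j _ => hm2 j J) h1).trans ?_
    refine (Finset.sum_le_sum fun j _ => ?_).trans (ENNReal.sum_le_tsum _)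
    exact (eLpNorm_sum_le (fun k _ => hm j k) h1).trans (ENNReal.sum_le_tsum _)

lemma Fjk_norm_le {s : ℝ} (hs1 : 1 ≤ s) (hs2 : s ≤ 2) : ∃ C : ℝ≥0∞, C ≠ ⊤ ∧
    ∀ (r A : ℝ), 0 < r → 1 ≤ 2 * s / r → BH s r A → ∀ (S : Set (ℝ × ℝ)), MeasurableSet S →
    volume S ≠ ⊤ → ∀ (j k : ℕ) (M : ℝ≥0∞),
    (∀ n m, volume (S ∩ cs (2 ^ (j + 1)) (2 ^ (k + 1)) n m) ≤ M) →
    eLpNorm (Fjk S j k) (ENNReal.ofReal s) volume ≤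
      C * (ENNReal.ofReal A ^ s *
        ENNReal.ofReal (2 ^ (j + 1) * 2 ^ (k + 1)) ^ (2 - 2 * s + 2 * s / r) *
        (M ^ (2 * s / r - 1) * volume S)) ^ (1 / s) := by
  obtain ⟨C, hC, h⟩ := scaled_grid_max hs1 hs2
  have hs0 : 0 < s := by linarith
  refine ⟨16 * C ^ (1 / s), ENNReal.mul_ne_top (by simp)
    (ENNReal.rpow_ne_top_of_nonneg (by positivity) hC), ?_⟩
  intro r A hr hsr hBH S hS hf j k M hM
  have h1 : (1 : ℝ≥0∞) ≤ ENNReal.ofReal s := by simpa using hs1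
  set B := (ENNReal.ofReal A ^ s *
        ENNReal.ofReal (2 ^ (j + 1) * 2 ^ (k + 1)) ^ (2 - 2 * s + 2 * s / r) *
        (M ^ (2 * s / r - 1) * volume S)) with hB
  have hD : ∀ d ∈ Dset, 2 ≤ |d| ∧ |d| ≤ 5 := by decide
  have hin : ∀ d ∈ Dset, ∀ e ∈ Dset, eLpNorm (fun p => ∑ n ∈ Nd j d, ∑ m ∈ Nd k e,
      extOp (chi (S ∩ cs (2 ^ (j + 1)) (2 ^ (k + 1)) n m)) p *
      extOp (chi (S ∩ cs (2 ^ (j + 1)) (2 ^ (k + 1)) (n + d) (m + e))) p) (ENNReal.ofReal s) volume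
      ≤ C ^ (1 / s) * B ^ (1 / s) := by
    intro d hd e he
    rw [eLpNorm_eq_lintegral_rpow_enorm_toReal (by simpa using hs0) (by simp),
      ENNReal.toReal_ofReal hs0.le, ← ENNReal.mul_rpow_of_nonneg _ _ (by positivity)]
    gcongr
    exact h r A hr hsr hBH S hS _ _ (by positivity) (by positivity) M hM _ _ d e
      (hD d hd).1 (hD d hd).2 (hD e he).1 (hD e he).2
  have hmm := fun d e => (Fjk_inner_continuous hS hf (2 ^ (j + 1)) (2 ^ (k + 1)) (Nd j d) (Nd k e)
    d e).aestronglyMeasurable (μ := volume)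
  have hF : Fjk S j k = ∑ d ∈ Dset, ∑ e ∈ Dset, fun p => ∑ n ∈ Nd j d, ∑ m ∈ Nd k e,
      extOp (chi (S ∩ cs (2 ^ (j + 1)) (2 ^ (k + 1)) n m)) p *
      extOp (chi (S ∩ cs (2 ^ (j + 1)) (2 ^ (k + 1)) (n + d) (m + e))) p := by
    ext p; simp [Fjk]
  rw [hF]
  refine (eLpNorm_sum_le (fun d _ => Finset.aestronglyMeasurable_sum _ fun e _ => hmm d e) h1).trans ?_
  calc _ ≤ ∑ d ∈ Dset, ∑ e ∈ Dset, C ^ (1 / s) * B ^ (1 / s) := by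
        refine Finset.sum_le_sum fun d hd => ?_
        refine (eLpNorm_sum_le (fun e _ => hmm d e) h1).trans ?_
        exact Finset.sum_le_sum fun e he => hin d hd e he
    _ = _ := by
        simp only [Finset.sum_const, nsmul_eq_mul, show Dset.card = 4 from by decide]
        push_cast; ring

/-- Summation of the dyadic series. -/
lemma dyadic_series {a v : ℝ} (ha : 0 < a) (hv : 0 < v) : ∃ C : ℝ≥0∞, C ≠ ⊤ ∧
    ∀ P : ℝ≥0∞, ∑' j : ℕ, ((2 : ℝ≥0∞) ^ (j + 1)) ^ a *
      (min ((2 : ℝ≥0∞) ^ (j + 1))⁻¹ P) ^ (a + v) ≤ C * P ^ v := by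
  have hq : ∀ u : ℝ, 0 < u → (1 - ((2 : ℝ≥0∞)⁻¹ ^ u))⁻¹ ≠ ⊤ := by
    intro u hu
    rw [ENNReal.inv_ne_top]
    exact (tsub_pos_of_lt (ENNReal.rpow_lt_one (by simp) hu)).ne'
  refine ⟨(1 - ((2 : ℝ≥0∞)⁻¹ ^ a))⁻¹ + (1 - ((2 : ℝ≥0∞)⁻¹ ^ v))⁻¹,
    ENNReal.add_ne_top.2 ⟨hq a ha, hq v hv⟩, ?_⟩
  intro P
  have hav : 0 < a + v := by positivity
  rcases eq_or_ne P 0 with rfl | hP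
  · simp [ENNReal.zero_rpow_of_pos hav]
  have hex : ∃ n : ℕ, ((2 : ℝ≥0∞) ^ (n + 1))⁻¹ ≤ P := by
    obtain ⟨n, hn⟩ := ENNReal.exists_inv_two_pow_lt hP
    refine ⟨n, le_trans ?_ hn.le⟩
    rw [← ENNReal.inv_pow, ENNReal.inv_le_inv]
    exact pow_le_pow_right₀ (by norm_num) (Nat.le_succ n)
  classical
  set n := Nat.find hex with hn
  have hn1 : ((2 : ℝ≥0∞) ^ (n + 1))⁻¹ ≤ P := Nat.find_spec hex
  have hn2 : 0 < n → P ≤ ((2 : ℝ≥0∞) ^ n)⁻¹ := by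
    intro h0
    have := Nat.find_min hex (m := n - 1) (by omega)
    rw [Nat.sub_add_cancel h0] at this
    exact (not_le.1 this).le
  have hp0 : ∀ i : ℕ, (2 : ℝ≥0∞) ^ i ≠ 0 := fun i => by simp
  have hpt : ∀ i : ℕ, (2 : ℝ≥0∞) ^ i ≠ ⊤ := fun i => by simp
  set f : ℕ → ℝ≥0∞ := fun j => ((2 : ℝ≥0∞) ^ (j + 1)) ^ a *
      (min ((2 : ℝ≥0∞) ^ (j + 1))⁻¹ P) ^ (a + v) with hf
  have hsmall : ∀ j, f (j + n) ≤ P ^ v * ((2 : ℝ≥0∞)⁻¹ ^ v) ^ j := by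
    intro j
    calc f (j + n) ≤ ((2 : ℝ≥0∞) ^ (j + n + 1)) ^ a * (((2 : ℝ≥0∞) ^ (j + n + 1))⁻¹) ^ (a + v) := by
          simp only [hf]; gcongr; exact min_le_left _ _
      _ = (((2 : ℝ≥0∞) ^ (j + n + 1))⁻¹) ^ v := by
          rw [ENNReal.rpow_add _ _ (by simp) (by simp), ← mul_assoc,
            ← ENNReal.mul_rpow_of_nonneg _ _ ha.le, ENNReal.mul_inv_cancel (hp0 _) (hpt _)]
          simp
      _ = (((2 : ℝ≥0∞) ^ (n + 1))⁻¹ * (2 : ℝ≥0∞)⁻¹ ^ j) ^ v := by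
          congr 1
          rw [ENNReal.inv_pow, ENNReal.inv_pow, ← pow_add]; congr 1; ring
      _ ≤ (P * (2 : ℝ≥0∞)⁻¹ ^ j) ^ v := by gcongr
      _ = _ := by
          rw [ENNReal.mul_rpow_of_nonneg _ _ hv.le, ← ENNReal.rpow_natCast,
            ← ENNReal.rpow_natCast, ← ENNReal.rpow_mul, ← ENNReal.rpow_mul, mul_comm v]
  have hbig : ∀ j ∈ Finset.range n, f (n - 1 - j) ≤ P ^ v * ((2 : ℝ≥0∞)⁻¹ ^ a) ^ j := by
    intro j hj
    rw [Finset.mem_range] at hj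
    have e1 : n - 1 - j + 1 = n - j := by omega
    have hPt : P ≠ ⊤ := ne_top_of_le_ne_top (by simp) (hn2 (by omega))
    calc f (n - 1 - j) ≤ ((2 : ℝ≥0∞) ^ (n - j)) ^ a * P ^ (a + v) := by
          simp only [hf, e1]; gcongr; exact min_le_right _ _
      _ = P ^ v * ((2 : ℝ≥0∞) ^ (n - j) * P) ^ a := by
          rw [ENNReal.rpow_add _ _ hP hPt, ENNReal.mul_rpow_of_nonneg _ _ ha.le]; ring
      _ ≤ P ^ v * ((2 : ℝ≥0∞) ^ (n - j) * ((2 : ℝ≥0∞) ^ n)⁻¹) ^ a := by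
          gcongr; exact hn2 (by omega)
      _ = P ^ v * ((2 : ℝ≥0∞)⁻¹ ^ j) ^ a := by
          congr 2
          obtain ⟨i, hi⟩ : ∃ i, n = i + j := ⟨n - j, by omega⟩
          rw [hi, Nat.add_sub_cancel, pow_add, ENNReal.mul_inv (Or.inl (hp0 _)) (Or.inl (hpt _)),
            ← mul_assoc, ENNReal.mul_inv_cancel (hp0 _) (hpt _), one_mul, ENNReal.inv_pow]
      _ = _ := by
          rw [← ENNReal.rpow_natCast, ← ENNReal.rpow_natCast, ← ENNReal.rpow_mul,
            ← ENNReal.rpow_mul, mul_comm a]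
  calc ∑' j, f j = ∑ j ∈ Finset.range n, f j + ∑' j, f (j + n) :=
        (ENNReal.summable.sum_add_tsum_nat_add' ).symm
    _ = ∑ j ∈ Finset.range n, f (n - 1 - j) + ∑' j, f (j + n) := by rw [Finset.sum_range_reflect]
    _ ≤ ∑' j, P ^ v * ((2 : ℝ≥0∞)⁻¹ ^ a) ^ j + ∑' j, P ^ v * ((2 : ℝ≥0∞)⁻¹ ^ v) ^ j := by
        gcongr with j
        · exact (Finset.sum_le_sum hbig).trans (ENNReal.sum_le_tsum _)
        · exact hsmall j
    _ = _ := by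
        rw [ENNReal.tsum_mul_left, ENNReal.tsum_mul_left, ENNReal.tsum_geometric,
          ENNReal.tsum_geometric]
        ring

/-- The projection of `fiberPiece` to the first coordinate axis. -/
def piK (Ω : Set (ℝ × ℝ)) (K : ℕ) : Set ℝ :=
  {x | (2 : ℝ≥0∞) ^ (-(K : ℤ) - 1) ≤ volume (vFiber Ω x) ∧
    volume (vFiber Ω x) ≤ (2 : ℝ≥0∞) ^ (-(K : ℤ) + 1)}

lemma vFiber_measurable {Ω : Set (ℝ × ℝ)} (hΩ : MeasurableSet Ω) :
    Measurable fun x => volume (vFiber Ω x) :=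
  measurable_measure_prodMk_left hΩ

lemma piK_measurable {Ω : Set (ℝ × ℝ)} (hΩ : MeasurableSet Ω) (K : ℕ) :
    MeasurableSet (piK Ω K) :=
  (measurableSet_le measurable_const (vFiber_measurable hΩ)).inter
    (measurableSet_le (vFiber_measurable hΩ) measurable_const)

lemma fiberPiece_eq (Ω : Set (ℝ × ℝ)) (K : ℕ) :
    fiberPiece Ω K = Ω ∩ Prod.fst ⁻¹' piK Ω K := rfl

lemma fiberPiece_measurable {Ω : Set (ℝ × ℝ)} (hΩ : MeasurableSet Ω) (K : ℕ) :
    MeasurableSet (fiberPiece Ω K) := by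
  rw [fiberPiece_eq]
  exact hΩ.inter (measurable_fst (piK_measurable hΩ K))

lemma piK_le {Ω : Set (ℝ × ℝ)} (hΩ : MeasurableSet Ω) (K : ℕ) :
    (2 : ℝ≥0∞) ^ (-(K : ℤ) - 1) * volume (piK Ω K) ≤ volume (fiberPiece Ω K) := by
  rw [Measure.volume_eq_prod, Measure.prod_apply (fiberPiece_measurable hΩ K),
    ← lintegral_indicator_const (piK_measurable hΩ K)]
  refine lintegral_mono fun x => ?_
  by_cases hx : x ∈ piK Ω K
  · rw [indicator_of_mem hx]
    refine hx.1.trans (measure_mono fun y hy => ?_)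
    exact ⟨hy, hx⟩
  · rw [indicator_of_notMem hx]; exact zero_le

lemma floor_volume (k : ℕ) (m : ℤ) :
    volume {y : ℝ | ⌊(2 : ℝ) ^ (k + 1) * y⌋ = m} ≤ ((2 : ℝ≥0∞) ^ (k + 1))⁻¹ := by
  have hp : (0 : ℝ) < 2 ^ (k + 1) := by positivity
  have : {y : ℝ | ⌊(2 : ℝ) ^ (k + 1) * y⌋ = m} =
      ((2 : ℝ) ^ (k + 1) * ·) ⁻¹' (Ico (m : ℝ) (m + 1)) := by
    ext y; simp only [mem_setOf_eq, Int.floor_eq_iff, mem_preimage, mem_Ico]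
  rw [this, Real.volume_preimage_mul_left hp.ne', Real.volume_Ico, abs_of_pos (by positivity),
    ENNReal.ofReal_inv_of_pos hp, ENNReal.ofReal_pow (by norm_num)]
  simp

lemma cell_measure {Ω S : Set (ℝ × ℝ)} (hΩ : MeasurableSet Ω) (K : ℕ)
    (hS : MeasurableSet S) (hSΩ : S ⊆ fiberPiece Ω K) (j k : ℕ) (n m : ℤ) :
    volume (S ∩ cs (2 ^ (j + 1)) (2 ^ (k + 1)) n m) ≤
      min ((2 : ℝ≥0∞) ^ (j + 1))⁻¹ (volume (piK Ω K)) *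
        min ((2 : ℝ≥0∞) ^ (k + 1))⁻¹ ((2 : ℝ≥0∞) ^ (-(K : ℤ) + 1)) := by
  set X := {x : ℝ | ⌊(2 : ℝ) ^ (j + 1) * x⌋ = n} ∩ piK Ω K with hX
  have hXm : MeasurableSet X := by
    refine MeasurableSet.inter ?_ (piK_measurable hΩ K)
    have : Measurable fun x : ℝ => ⌊(2 : ℝ) ^ (j + 1) * x⌋ := by fun_prop
    exact this (measurableSet_singleton n)
  calc volume (S ∩ cs (2 ^ (j + 1)) (2 ^ (k + 1)) n m)
      = ∫⁻ x, volume (Prod.mk x ⁻¹' (S ∩ cs (2 ^ (j + 1)) (2 ^ (k + 1)) n m)) := by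
        rw [Measure.volume_eq_prod, Measure.prod_apply (hS.inter (cs_measurable _ _ _ _))]
    _ ≤ ∫⁻ x, X.indicator (fun _ => min ((2 : ℝ≥0∞) ^ (k + 1))⁻¹
          ((2 : ℝ≥0∞) ^ (-(K : ℤ) + 1))) x := by
        refine lintegral_mono fun x => ?_
        by_cases hx : x ∈ X
        · rw [indicator_of_mem hx]
          refine le_min ?_ ?_
          · refine le_trans (measure_mono fun y hy => ?_) (floor_volume k m)
            exact hy.2.2
          · refine le_trans (measure_mono fun y hy => ?_) hx.2.2
            exact (hSΩ hy.1).1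
        · rw [indicator_of_notMem hx]
          have : Prod.mk x ⁻¹' (S ∩ cs (2 ^ (j + 1)) (2 ^ (k + 1)) n m) = ∅ := by
            ext y
            simp only [mem_preimage, mem_empty_iff_false, iff_false]
            intro hy
            exact hx ⟨hy.2.1, (hSΩ hy.1).2⟩
          rw [this]; simp
    _ = min ((2 : ℝ≥0∞) ^ (k + 1))⁻¹ ((2 : ℝ≥0∞) ^ (-(K : ℤ) + 1)) * volume X :=
        lintegral_indicator_const hXm _
    _ ≤ _ := by
        rw [mul_comm]
        gcongr
        exact le_min ((measure_mono inter_subset_left).trans (floor_volume j n))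
          (measure_mono inter_subset_right)

/-- The main estimate, for positive `r`. -/
lemma main_pos (s r A : ℝ) (hs₁ : 3 / 2 < s) (hs₂ : s < 2) (hr0 : 0 < r) (hr : r < s / (s - 1))
    (hBH : BH s r A) : ∃ C : ℝ≥0∞, C ≠ ⊤ ∧
      ∀ Ω : Set (ℝ × ℝ), MeasurableSet Ω → Ω ⊆ Icc 0 1 ×ˢ Icc 0 1 →
        ∀ K : ℕ, ∀ Ω' ⊆ fiberPiece Ω K, MeasurableSet Ω' →
          eLpNorm (fun p => extOp (chi Ω') p * extOp (chi Ω') p) (ENNReal.ofReal s) volume ≤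
            C * volume (fiberPiece Ω K) ^ (2 * (1 - 1 / s)) := by
  have hs0 : 0 < s := by linarith
  have hsr : s - 1 < s / r := by
    rw [lt_div_iff₀ (by linarith)] at hr
    rw [lt_div_iff₀ hr0]; linarith
  have e2 : 2 * s / r = 2 * (s / r) := by ring
  set α := 2 - 2 * s + 2 * s / r with hα
  have hα0 : 0 < α := by rw [hα, e2]; linarith
  set β := 2 * s / r with hβ
  have hβ1 : 1 ≤ β := by rw [e2]; linarith
  set a := α / s with ha
  set v := (2 * s - 3) / s with hv
  have ha0 : 0 < a := by positivity
  have hv0 : 0 < v := div_pos (by linarith) hs0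
  have hav : (β - 1) * (1 / s) = a + v := by
    rw [ha, hv, hα]; field_simp; ring
  obtain ⟨C₁, hC₁, h₁⟩ := Fjk_norm_le (s := s) (by linarith) hs₂.le
  obtain ⟨C₂, hC₂, h₂⟩ := dyadic_series ha0 hv0
  refine ⟨C₁ * ENNReal.ofReal A * (C₂ * C₂) * 4 ^ v, ?_, ?_⟩
  · refine ENNReal.mul_ne_top (ENNReal.mul_ne_top (ENNReal.mul_ne_top hC₁ (by simp))
      (ENNReal.mul_ne_top hC₂ hC₂)) (ENNReal.rpow_ne_top_of_nonneg hv0.le (by simp))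
  intro Ω hΩ hΩ1 K S hSK hS
  have hS1 : S ⊆ Icc 0 1 ×ˢ Icc 0 1 := fun ξ h => hΩ1 (hSK h).1
  have hf : volume S ≠ ⊤ := by
    refine ((measure_mono hS1).trans_lt ?_).ne
    rw [Measure.volume_eq_prod, Measure.prod_prod]; simp
  set P := volume (piK Ω K)
  set κ := (2 : ℝ≥0∞) ^ (-(K : ℤ) + 1) with hκ
  set V := volume (fiberPiece Ω K)
  have hVS : volume S ≤ V := measure_mono hSK
  have hPκ : P * κ ≤ 4 * V := by
    have h := piK_le hΩ K
    have : κ = 4 * (2 : ℝ≥0∞) ^ (-(K : ℤ) - 1) := by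
      rw [hκ, show -(K : ℤ) + 1 = 2 + (-(K : ℤ) - 1) by ring, ENNReal.zpow_add (by simp) (by simp)]
      norm_num
    rw [this, mul_comm, mul_assoc]
    gcongr
  set x : ℕ → ℝ≥0∞ := fun j => ((2 : ℝ≥0∞) ^ (j + 1)) ^ a *
      (min ((2 : ℝ≥0∞) ^ (j + 1))⁻¹ P) ^ (a + v) with hx
  set y : ℕ → ℝ≥0∞ := fun j => ((2 : ℝ≥0∞) ^ (j + 1)) ^ a *
      (min ((2 : ℝ≥0∞) ^ (j + 1))⁻¹ κ) ^ (a + v) with hy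
  have hjk : ∀ j k, eLpNorm (Fjk S j k) (ENNReal.ofReal s) volume ≤
      C₁ * ENNReal.ofReal A * V ^ (1 / s) * (x j * y k) := by
    intro j k
    refine (h₁ r A hr0 hβ1 hBH S hS hf j k _ (cell_measure hΩ K hS hSK j k)).trans ?_
    have hi : (0 : ℝ) ≤ 1 / s := by positivity
    have hr1 : ∀ z : ℝ≥0∞, (z ^ α) ^ (1 / s) = z ^ a := fun z => by
      rw [← ENNReal.rpow_mul]; congr 1; rw [ha]; ring
    have hr2 : ∀ z : ℝ≥0∞, (z ^ (β - 1)) ^ (1 / s) = z ^ (a + v) := fun z => by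
      rw [← ENNReal.rpow_mul, hav]
    have hr3 : ∀ z : ℝ≥0∞, (z ^ s) ^ (1 / s) = z := fun z => by
      rw [← ENNReal.rpow_mul, mul_one_div_cancel hs0.ne', ENNReal.rpow_one]
    have hof : ENNReal.ofReal (2 ^ (j + 1) * 2 ^ (k + 1)) =
        (2 : ℝ≥0∞) ^ (j + 1) * 2 ^ (k + 1) := by
      rw [ENNReal.ofReal_mul (by positivity), ENNReal.ofReal_pow (by norm_num),
        ENNReal.ofReal_pow (by norm_num)]
      simp
    rw [ENNReal.mul_rpow_of_nonneg _ _ hi, ENNReal.mul_rpow_of_nonneg _ _ hi,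
      ENNReal.mul_rpow_of_nonneg _ _ hi, hr1, hr2, hr3, hof, ENNReal.mul_rpow_of_nonneg _ _ ha0.le,
      ENNReal.mul_rpow_of_nonneg _ _ (by positivity : (0 : ℝ) ≤ a + v)]
    calc _ ≤ C₁ * (ENNReal.ofReal A * (((2 : ℝ≥0∞) ^ (j + 1)) ^ a * ((2 : ℝ≥0∞) ^ (k + 1)) ^ a) *
          ((min ((2 : ℝ≥0∞) ^ (j + 1))⁻¹ P) ^ (a + v) * (min ((2 : ℝ≥0∞) ^ (k + 1))⁻¹ κ) ^ (a + v) *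
            V ^ (1 / s))) := by gcongr
      _ = _ := by simp only [hx, hy]; ring
  calc _ ≤ ∑' j, ∑' k, eLpNorm (Fjk S j k) (ENNReal.ofReal s) volume :=
        sq_norm_le (by linarith) hS hf hS1
    _ ≤ ∑' j, ∑' k, C₁ * ENNReal.ofReal A * V ^ (1 / s) * (x j * y k) := by
        gcongr with j k; exact hjk j k
    _ = C₁ * ENNReal.ofReal A * V ^ (1 / s) * ((∑' j, x j) * ∑' k, y k) := by
        simp only [ENNReal.tsum_mul_left, ENNReal.tsum_mul_right]
    _ ≤ C₁ * ENNReal.ofReal A * V ^ (1 / s) * ((C₂ * P ^ v) * (C₂ * κ ^ v)) := by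
        gcongr
        · exact h₂ P
        · exact h₂ κ
    _ = C₁ * ENNReal.ofReal A * V ^ (1 / s) * (C₂ * C₂ * (P * κ) ^ v) := by
        rw [ENNReal.mul_rpow_of_nonneg _ _ hv0.le]; ring
    _ ≤ C₁ * ENNReal.ofReal A * V ^ (1 / s) * (C₂ * C₂ * (4 * V) ^ v) := by gcongr
    _ = C₁ * ENNReal.ofReal A * (C₂ * C₂) * 4 ^ v * (V ^ (1 / s) * V ^ v) := by
        rw [ENNReal.mul_rpow_of_nonneg _ _ hv0.le]; ring
    _ = _ := by
        rw [← ENNReal.rpow_add_of_nonneg _ _ (by positivity) hv0.le]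
        congr 2
        rw [hv]; field_simp; ring

lemma BH_nonpos {s r A : ℝ} (hr : r ≤ 0) (h : BH s r A) : BH s 1 A := by
  intro a₁ a₂ b₁ b₂ h1 h2 h3 h4 f g hf hg
  refine (h a₁ a₂ b₁ b₂ h1 h2 h3 h4 f g hf hg).trans ?_
  rw [ENNReal.ofReal_of_nonpos hr]
  simp

lemma main_all (s r A : ℝ) (hs₁ : 3 / 2 < s) (hs₂ : s < 2) (hr : r < s / (s - 1))
    (hBH : BH s r A) : ∃ C : ℝ≥0∞, C ≠ ⊤ ∧
      ∀ Ω : Set (ℝ × ℝ), MeasurableSet Ω → Ω ⊆ Icc 0 1 ×ˢ Icc 0 1 →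
        ∀ K : ℕ, ∀ Ω' ⊆ fiberPiece Ω K, MeasurableSet Ω' →
          eLpNorm (fun p => extOp (chi Ω') p * extOp (chi Ω') p) (ENNReal.ofReal s) volume ≤
            C * volume (fiberPiece Ω K) ^ (2 * (1 - 1 / s)) := by
  rcases lt_or_ge 0 r with h | h
  · exact main_pos s r A hs₁ hs₂ h hr hBH
  · refine main_pos s 1 A hs₁ hs₂ one_pos ?_ (BH_nonpos h hBH)
    rw [lt_div_iff₀ (by linarith)]; linarith

/-- Vargas's constant-fiber-length estimate: under BH(s,r) with `3/2 < s < 2`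
and `r < s'`, there is `C = C(s,r,A)` such that for every measurable `Ω ⊆ [0,1]²`, every
`K ≥ 0`, and every measurable `Ω' ⊆ Ω(K)`, `∥𝓔χ_{Ω'}∥_{L^{2s}} ≤ C|Ω(K)|^{1/s'}`. -/
theorem stmt4 (s r A : ℝ) (hs₁ : 3 / 2 < s) (hs₂ : s < 2) (hr : r < s / (s - 1))
    (hBH : BH s r A) :
    ∃ C : ℝ, 0 < C ∧
      ∀ Ω : Set (ℝ × ℝ), MeasurableSet Ω → Ω ⊆ Icc 0 1 ×ˢ Icc 0 1 →
        ∀ K : ℕ, ∀ Ω' ⊆ fiberPiece Ω K, MeasurableSet Ω' →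
          eLpNorm (extOp (chi Ω')) (ENNReal.ofReal (2 * s)) volume ≤
            ENNReal.ofReal C * volume (fiberPiece Ω K) ^ (1 - 1 / s) := by
  obtain ⟨C, hC, h⟩ := main_all s r A hs₁ hs₂ hr hBH
  have hs0 : 0 < s := by linarith
  have hC2 : C ^ (1 / 2 : ℝ) ≠ ⊤ := ENNReal.rpow_ne_top_of_nonneg (by norm_num) hC
  refine ⟨(C ^ (1 / 2 : ℝ)).toReal + 1, by positivity, ?_⟩
  intro Ω hΩ hΩ1 K Ω' hK hΩ'
  have h1 := h Ω hΩ hΩ1 K Ω' hK hΩ'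
  have h2 := eLpNorm_norm_rpow (p := ENNReal.ofReal s) (μ := volume) (extOp (chi Ω'))
    (two_pos : (0 : ℝ) < 2)
  rw [← ENNReal.ofReal_mul hs0.le, mul_comm s 2] at h2
  have h3 : eLpNorm (fun p => ‖extOp (chi Ω') p‖ ^ (2 : ℝ)) (ENNReal.ofReal s) volume =
      eLpNorm (fun p => extOp (chi Ω') p * extOp (chi Ω') p) (ENNReal.ofReal s) volume := by
    refine eLpNorm_congr_norm_ae (Filter.Eventually.of_forall fun p => ?_)
    rw [norm_mul, Real.rpow_two, norm_pow, norm_norm, pow_two]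
  rw [← h3, h2] at h1
  set N := eLpNorm (extOp (chi Ω')) (ENNReal.ofReal (2 * s)) volume
  have h4 : N = (N ^ (2 : ℝ)) ^ (1 / 2 : ℝ) := by
    rw [← ENNReal.rpow_mul]; norm_num
  rw [h4]
  calc (N ^ (2 : ℝ)) ^ (1 / 2 : ℝ)
      ≤ (C * volume (fiberPiece Ω K) ^ (2 * (1 - 1 / s))) ^ (1 / 2 : ℝ) := by gcongr
    _ = C ^ (1 / 2 : ℝ) * volume (fiberPiece Ω K) ^ (1 - 1 / s) := by
        rw [ENNReal.mul_rpow_of_nonneg _ _ (by norm_num), ← ENNReal.rpow_mul]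
        congr 2; ring
    _ ≤ _ := by
        gcongr
        rw [ENNReal.le_ofReal_iff_toReal_le hC2 (by positivity)]
        linarith
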